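/- arXiv:2303.14316 — 2 statements merged into one kernel-verified Lean document; each statement's English description precedes it below -/
import Mathlib

section
/- There exists a constant c > 0 such that for all sufficiently large M one has Σ_{M ≤ n < 2M} G(n) ≥ c·M²·(log M)^{1/4} / (log log M). -/
open Real Filter Finset
open scoped Classical

/-- `n` is a sum of two squares. -/
def IsSumTwoSquares (n : ℕ) : Prop := ∃ x y : ℤ, (n : ℤ) = x ^ 2 + y ^ 2

/-- Indicator function of the sums of two squares. -/
noncomputable def b (n : ℕ) : ℕ := if IsSumTwoSquares n then 1 else 0

/-- `G n = Σ_{1 ≤ k ≤ (log n)^{5/8}} Σ_{1 ≤ m ≤ n (log n)^{5/8}} b(m)·b(m + nk)`. -/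
noncomputable def G (n : ℕ) : ℕ :=
  ∑ k ∈ Finset.Icc 1 ⌊Real.log n ^ ((5:ℝ)/8)⌋₊,
    ∑ m ∈ Finset.Icc 1 ⌊(n : ℝ) * Real.log n ^ ((5:ℝ)/8)⌋₊,
      b m * b (m + n * k)

/-- The nontrivial character modulo `4`, as a real-valued function on `ℕ`. -/
noncomputable def chi (n : ℕ) : ℝ := ((ZMod.χ₄ (n : ZMod 4) : ℤ) : ℝ)

lemma chi_eq (n : ℕ) :
    chi n = if n % 2 = 0 then 0 else if n % 4 = 1 then 1 else -1 := by
  rw [chi, ZMod.χ₄_nat_eq_if_mod_four]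
  split_ifs <;> simp

lemma chi_mul (m n : ℕ) : chi (m * n) = chi m * chi n := by
  simp only [chi]
  push_cast
  rw [map_mul]
  push_cast
  rfl

lemma abs_chi_le_one (n : ℕ) : |chi n| ≤ 1 := by
  rw [chi_eq]
  split_ifs <;> simp

/-- The partial sums `∑ i < n, chi i`. -/
def chiPartialSum (n : ℕ) : ℝ := if n % 4 = 2 ∨ n % 4 = 3 then 1 else 0

lemma chiPartialSum_succ (n : ℕ) : chiPartialSum (n + 1) = chiPartialSum n + chi n := by
  rw [chi_eq, chiPartialSum, chiPartialSum]
  have h : n % 4 < 4 := Nat.mod_lt _ (by norm_num)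
  have h2 : n % 2 = (n % 4) % 2 := by omega
  have h3 : (n + 1) % 4 = (n % 4 + 1) % 4 := by omega
  rw [h2, h3]
  interval_cases n % 4 <;> norm_num

lemma abs_chiPartialSum_sub_le (m n : ℕ) : |chiPartialSum m - chiPartialSum n| ≤ 1 := by
  unfold chiPartialSum
  split_ifs <;> norm_num

lemma abs_sum_chi_mul_le {f : ℕ → ℝ} {m : ℕ} (hf : ∀ n, m ≤ n → f (n + 1) ≤ f n)
    (hf0 : ∀ n, m ≤ n → 0 ≤ f n) {N : ℕ} (hN : m ≤ N) :
    |∑ n ∈ Ico m N, chi n * f n| ≤ f m := by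
  have key : |∑ n ∈ Ico m N, chi n * f n - (chiPartialSum N - chiPartialSum m) * f N|
      ≤ f m - f N := by
    induction N, hN using Nat.le_induction with
    | base => simp
    | succ N hN ih =>
      rw [sum_Ico_succ_top hN, chiPartialSum_succ]
      have h1 := hf N hN
      have h2 := abs_chiPartialSum_sub_le (N + 1) m
      rw [chiPartialSum_succ] at h2
      calc _ = |(∑ n ∈ Ico m N, chi n * f n - (chiPartialSum N - chiPartialSum m) * f N)
              + (chiPartialSum N + chi N - chiPartialSum m) * (f N - f (N + 1))| := by
            congr 1; ring
        _ ≤ (f m - f N) + 1 * (f N - f (N + 1)) := by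
            refine (abs_add_le _ _).trans (add_le_add ih ?_)
            rw [abs_mul, abs_of_nonneg (sub_nonneg.2 h1)]
            exact mul_le_mul_of_nonneg_right h2 (sub_nonneg.2 h1)
        _ = _ := by ring
  have h1 : |(chiPartialSum N - chiPartialSum m) * f N| ≤ f N := by
    rw [abs_mul, abs_of_nonneg (hf0 N hN)]
    exact mul_le_of_le_one_left (hf0 N hN) (abs_chiPartialSum_sub_le _ _)
  calc _ = |(∑ n ∈ Ico m N, chi n * f n - (chiPartialSum N - chiPartialSum m) * f N)
          + (chiPartialSum N - chiPartialSum m) * f N| := by congr 1; ring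
    _ ≤ (f m - f N) + f N := (abs_add_le _ _).trans (add_le_add key h1)
    _ = f m := by ring

lemma Ioc_zero_eq_Ico (N : ℕ) : Ioc 0 N = Ico 1 (N + 1) := by
  ext; simp; omega

/-- An alternating sum with decreasing terms is bounded below by its first two terms. -/
lemma le_sum_chi_mul {f : ℕ → ℝ} (hf : ∀ n, 3 ≤ n → f (n + 1) ≤ f n)
    (hf0 : ∀ n, 3 ≤ n → 0 ≤ f n) {N : ℕ} (hN : 1 ≤ N) :
    f 1 - f 3 ≤ ∑ n ∈ Ioc 0 N, chi n * f n := by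
  have h1 : chi 1 = 1 := by rw [chi_eq]; norm_num
  have h2 : chi 2 = 0 := by rw [chi_eq]; norm_num
  have h3 := hf0 3 le_rfl
  rw [Ioc_zero_eq_Ico]
  obtain rfl | h := hN.eq_or_lt
  · simp [h1, h3]
  · rw [sum_eq_sum_Ico_succ_bot (by omega), sum_eq_sum_Ico_succ_bot (by omega), h1, h2]
    have := (abs_le.1 (abs_sum_chi_mul_le hf hf0 (show 3 ≤ N + 1 by omega))).1
    norm_num at this ⊢
    linarith

/-- The partial sums of `L(1, χ₄)` are bounded below. -/
lemma two_thirds_le_sum_chi_div {N : ℕ} (hN : 1 ≤ N) :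
    2 / 3 ≤ ∑ n ∈ Ioc 0 N, chi n / n := by
  have := le_sum_chi_mul (f := fun n : ℕ ↦ (n : ℝ)⁻¹)
    (fun n hn ↦ by
      have : (0 : ℝ) < n := by exact_mod_cast (by omega : 0 < n)
      exact inv_anti₀ this (by push_cast; linarith))
    (fun n _ ↦ by positivity) hN
  norm_num at this
  simpa [div_eq_mul_inv] using this

lemma abs_sum_chi_div_sub_le {m N : ℕ} (h : m ≤ N) :
    |∑ n ∈ Ioc 0 N, chi n / n - ∑ n ∈ Ioc 0 m, chi n / n| ≤ 1 / (m + 1) := by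
  have := abs_sum_chi_mul_le (f := fun n : ℕ ↦ (n : ℝ)⁻¹) (m := m + 1) (N := N + 1)
    (fun n hn ↦ by
      have : (0 : ℝ) < n := by exact_mod_cast (by omega : 0 < n)
      exact inv_anti₀ this (by push_cast; linarith))
    (fun n _ ↦ by positivity) (by omega)
  rw [Ioc_zero_eq_Ico, Ioc_zero_eq_Ico,
    ← sum_Ico_consecutive _ (show 1 ≤ m + 1 by omega) (show m + 1 ≤ N + 1 by omega),
    add_sub_cancel_left]
  simpa [div_eq_mul_inv] using this

open ArithmeticFunction in
lemma sum_vonMangoldt_mul_div (N : ℕ) :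
    ∑ d ∈ Ioc 0 N, vonMangoldt d * ((N / d : ℕ) : ℝ) = Real.log N.factorial := by
  have h := sum_Ioc_mul_zeta_eq_sum vonMangoldt N
  rw [vonMangoldt_mul_zeta] at h
  rw [← h]
  induction N with
  | zero => simp
  | succ N ih =>
    rw [Finset.sum_Ioc_succ_top (by omega), ih (sum_Ioc_mul_zeta_eq_sum vonMangoldt N ▸ by
      rw [vonMangoldt_mul_zeta]), Nat.factorial_succ]
    push_cast
    rw [Real.log_mul (by positivity) (by positivity), add_comm]
    simp [log_apply]

lemma log_sub_one_le_sum_vonMangoldt_div {N : ℕ} (hN : 1 ≤ N) :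
    Real.log N - 1 ≤ ∑ n ∈ Ioc 0 N, ArithmeticFunction.vonMangoldt n / n := by
  have hN' : (0 : ℝ) < N := by exact_mod_cast hN
  have h1 : N * Real.log N - N ≤ Real.log N.factorial := by
    have := Stirling.le_log_factorial_stirling (n := N) (by omega)
    have h2 : 0 ≤ Real.log N := Real.log_nonneg (by exact_mod_cast hN)
    have h3 : 0 ≤ Real.log (2 * π) := Real.log_nonneg (by linarith [Real.pi_gt_three])
    linarith
  rw [← sum_vonMangoldt_mul_div] at h1
  have h2 : ∑ d ∈ Ioc 0 N, ArithmeticFunction.vonMangoldt d * ((N / d : ℕ) : ℝ) ≤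
      N * ∑ n ∈ Ioc 0 N, ArithmeticFunction.vonMangoldt n / n := by
    rw [mul_sum]
    refine sum_le_sum fun d _ ↦ ?_
    calc _ ≤ ArithmeticFunction.vonMangoldt d * ((N : ℝ) / d) :=
          mul_le_mul_of_nonneg_left Nat.cast_div_le ArithmeticFunction.vonMangoldt_nonneg
      _ = _ := by ring
  have h3 : N * (Real.log N - 1) ≤ N * ∑ n ∈ Ioc 0 N, ArithmeticFunction.vonMangoldt n / n := by
    linarith
  exact le_of_mul_le_mul_left h3 hN'

lemma psi_natCast (N : ℕ) :
    Chebyshev.psi N = ∑ n ∈ Ioc 0 N, ArithmeticFunction.vonMangoldt n := by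
  rw [Chebyshev.psi, Nat.floor_natCast]

lemma sum_vonMangoldt_div_le {N : ℕ} (hN : 1 ≤ N) :
    ∑ n ∈ Ioc 0 N, ArithmeticFunction.vonMangoldt n / n ≤ Real.log N + (Real.log 4 + 4) := by
  have hN' : (0 : ℝ) < N := by exact_mod_cast hN
  have h1 : Real.log N.factorial ≤ N * Real.log N := by
    rw [← Real.log_pow]
    exact Real.log_le_log (by positivity) (by exact_mod_cast Nat.factorial_le_pow N)
  have h0 := Chebyshev.psi_le_const_mul_self hN'.le
  rw [psi_natCast] at h0
  rw [← sum_vonMangoldt_mul_div] at h1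
  have h2 : N * ∑ n ∈ Ioc 0 N, ArithmeticFunction.vonMangoldt n / n ≤
      ∑ d ∈ Ioc 0 N, ArithmeticFunction.vonMangoldt d * ((N / d : ℕ) : ℝ) +
        ∑ n ∈ Ioc 0 N, ArithmeticFunction.vonMangoldt n := by
    rw [mul_sum, ← sum_add_distrib]
    refine sum_le_sum fun d hd ↦ ?_
    have hd0 : (0 : ℝ) < d := by exact_mod_cast (mem_Ioc.1 hd).1
    have : (N : ℝ) / d ≤ ((N / d : ℕ) : ℝ) + 1 := by
      rw [← Nat.floor_div_eq_div (K := ℝ)]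
      exact (Nat.lt_floor_add_one _).le
    calc _ = ArithmeticFunction.vonMangoldt d * ((N : ℝ) / d) := by ring
      _ ≤ ArithmeticFunction.vonMangoldt d * (((N / d : ℕ) : ℝ) + 1) :=
          mul_le_mul_of_nonneg_left this ArithmeticFunction.vonMangoldt_nonneg
      _ = _ := by ring
  have h3 : N * ∑ n ∈ Ioc 0 N, ArithmeticFunction.vonMangoldt n / n ≤
      N * (Real.log N + (Real.log 4 + 4)) := by
    linarith
  exact le_of_mul_le_mul_left h3 hN'

lemma sum_Ioc_sum_divisorsAntidiagonal (f g : ℕ → ℝ) (N : ℕ) :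
    ∑ n ∈ Ioc 0 N, ∑ x ∈ n.divisorsAntidiagonal, f x.1 * g x.2 =
      ∑ d ∈ Ioc 0 N, f d * ∑ m ∈ Ioc 0 (N / d), g m := by
  let F : (ℕ → ℝ) → ArithmeticFunction ℝ := fun f ↦ ⟨fun n ↦ if n = 0 then 0 else f n, by simp⟩
  have hF : ∀ f n, n ≠ 0 → F f n = f n := fun f n hn ↦ if_neg hn
  have h := ArithmeticFunction.sum_Ioc_mul_eq_sum_sum (F f) (F g) N
  convert h using 1
  · refine sum_congr rfl fun n hn ↦ ?_
    rw [ArithmeticFunction.mul_apply]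
    refine sum_congr rfl fun x hx ↦ ?_
    rw [hF _ _ (Nat.ne_zero_of_mem_divisorsAntidiagonal hx).1,
      hF _ _ (Nat.ne_zero_of_mem_divisorsAntidiagonal hx).2]
  · refine sum_congr rfl fun d hd ↦ ?_
    rw [hF _ _ (mem_Ioc.1 hd).1.ne']
    congr 1
    exact sum_congr rfl fun m hm ↦ (hF _ _ (mem_Ioc.1 hm).1.ne').symm

lemma sum_chi_mul_log_div (N : ℕ) :
    ∑ n ∈ Ioc 0 N, chi n * (Real.log n / n) =
      ∑ d ∈ Ioc 0 N, chi d * ArithmeticFunction.vonMangoldt d / d *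
        ∑ m ∈ Ioc 0 (N / d), chi m / m := by
  rw [← sum_Ioc_sum_divisorsAntidiagonal]
  refine sum_congr rfl fun n hn ↦ ?_
  have h := Nat.sum_divisorsAntidiagonal (fun i _ ↦ ArithmeticFunction.vonMangoldt i) (n := n)
  rw [ArithmeticFunction.vonMangoldt_sum] at h
  rw [← h, Finset.sum_div, Finset.mul_sum]
  refine sum_congr rfl fun x hx ↦ ?_
  have h1 := (Nat.ne_zero_of_mem_divisorsAntidiagonal hx).1
  have h2 := (Nat.ne_zero_of_mem_divisorsAntidiagonal hx).2
  rw [← (Nat.mem_divisorsAntidiagonal.1 hx).1, chi_mul]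
  push_cast
  field_simp

lemma log_div_antitone {n : ℕ} (hn : 3 ≤ n) :
    Real.log (n + 1 : ℕ) / (n + 1 : ℕ) ≤ Real.log n / n := by
  have h3 : (3 : ℝ) ≤ n := by exact_mod_cast hn
  have he := Real.exp_one_lt_d9
  exact Real.log_div_self_antitoneOn (show Real.exp 1 ≤ _ by linarith)
    (show Real.exp 1 ≤ _ by push_cast; linarith) (by push_cast; linarith)

lemma abs_sum_chi_mul_log_div_le (N : ℕ) :
    |∑ n ∈ Ioc 0 N, chi n * (Real.log n / n)| ≤ 1 := by
  have h1 : chi 1 = 1 := by rw [chi_eq]; norm_num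
  have h2 : chi 2 = 0 := by rw [chi_eq]; norm_num
  by_cases hN : N < 2
  · interval_cases N <;> simp
  · rw [Ioc_zero_eq_Ico, sum_eq_sum_Ico_succ_bot (by omega), sum_eq_sum_Ico_succ_bot (by omega),
      h1, h2]
    have := abs_sum_chi_mul_le (f := fun n : ℕ ↦ Real.log n / n) (m := 3) (N := N + 1)
      (fun n hn ↦ log_div_antitone hn) (fun n _ ↦ by positivity) (by omega)
    have h3 : Real.log 3 / 3 ≤ 1 := by
      have := Real.log_le_sub_one_of_pos (show (0:ℝ) < 3 by norm_num)
      linarith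
    norm_num at this ⊢
    linarith

/-- A form of Mertens' theorem for the character `chi`. -/
lemma abs_sum_chi_mul_vonMangoldt_div_le {N : ℕ} (hN : 1 ≤ N) :
    |∑ n ∈ Ioc 0 N, chi n * ArithmeticFunction.vonMangoldt n / n| ≤
      3 / 2 * (Real.log 4 + 5) := by
  have hN' : (0 : ℝ) < N := by exact_mod_cast hN
  set X : ℕ → ℝ := fun m ↦ ∑ n ∈ Ioc 0 m, chi n / n with hX
  set B := ∑ n ∈ Ioc 0 N, chi n * ArithmeticFunction.vonMangoldt n / n with hB
  have h0 := Chebyshev.psi_le_const_mul_self hN'.le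
  rw [psi_natCast] at h0
  have h1 : |X N * B - ∑ n ∈ Ioc 0 N, chi n * (Real.log n / n)| ≤ Real.log 4 + 4 := by
    rw [sum_chi_mul_log_div, hB, mul_sum, ← sum_sub_distrib]
    calc _ ≤ ∑ d ∈ Ioc 0 N, ArithmeticFunction.vonMangoldt d / N := by
          refine (abs_sum_le_sum_abs _ _).trans (sum_le_sum fun d hd ↦ ?_)
          have hd0 : (0 : ℝ) < d := by exact_mod_cast (mem_Ioc.1 hd).1
          have h2 := abs_sum_chi_div_sub_le (Nat.div_le_self N d)
          have h3 : 1 / (((N / d : ℕ) : ℝ) + 1) ≤ d / N := by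
            rw [div_le_div_iff₀ (by positivity) hN', one_mul, ← div_le_iff₀' hd0,
              ← Nat.floor_div_eq_div (K := ℝ)]
            exact (Nat.lt_floor_add_one _).le
          calc _ = |chi d| * (ArithmeticFunction.vonMangoldt d / d) * |X N - X (N / d)| := by
                rw [← abs_of_nonneg (div_nonneg (ArithmeticFunction.vonMangoldt_nonneg (n := d))
                  hd0.le), ← abs_mul, ← abs_mul]
                congr 1
                simp only [hX]
                ring
            _ ≤ 1 * (ArithmeticFunction.vonMangoldt d / d) * (d / N) := by
                have := div_nonneg (ArithmeticFunction.vonMangoldt_nonneg (n := d)) hd0.le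
                gcongr
                · exact abs_chi_le_one d
                · exact h2.trans h3
            _ = _ := by field_simp
      _ ≤ _ := by
          rw [← sum_div, div_le_iff₀ hN']
          exact h0
  have h4 := abs_sum_chi_mul_log_div_le N
  have h5 : |X N * B| ≤ Real.log 4 + 5 := by
    rw [abs_le] at *
    constructor <;> linarith
  have h6 : 2 / 3 ≤ X N := two_thirds_le_sum_chi_div hN
  rw [abs_mul, abs_of_nonneg (by linarith)] at h5
  have := mul_le_mul_of_nonneg_right h6 (abs_nonneg B)
  linarith

lemma exists_log_sub_le_sum_vonMangoldt :
    ∃ C : ℝ, ∀ m N : ℕ, 1 ≤ m → m ≤ N → Real.log N - Real.log m - C ≤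
      ∑ n ∈ Ioc m N, (1 + chi n) * (ArithmeticFunction.vonMangoldt n / n) := by
  refine ⟨1 + (Real.log 4 + 4) + 3 * (Real.log 4 + 5), fun m N hm hN ↦ ?_⟩
  have h1 := log_sub_one_le_sum_vonMangoldt_div (hm.trans hN)
  have h2 := sum_vonMangoldt_div_le hm
  have h3 := (abs_le.1 (abs_sum_chi_mul_vonMangoldt_div_le (hm.trans hN))).1
  have h4 := (abs_le.1 (abs_sum_chi_mul_vonMangoldt_div_le hm)).2
  have h5 : ∀ f : ℕ → ℝ, ∑ n ∈ Ioc m N, f n = ∑ n ∈ Ioc 0 N, f n - ∑ n ∈ Ioc 0 m, f n := by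
    intro f
    rw [← sum_Ioc_consecutive f (Nat.zero_le m) hN]
    ring
  have h6 : ∑ n ∈ Ioc m N, (1 + chi n) * (ArithmeticFunction.vonMangoldt n / n) =
      ∑ n ∈ Ioc m N, ArithmeticFunction.vonMangoldt n / n +
        ∑ n ∈ Ioc m N, chi n * ArithmeticFunction.vonMangoldt n / n := by
    rw [← sum_add_distrib]
    exact sum_congr rfl fun n _ ↦ by ring
  rw [h6, h5, h5]
  linarith

/-- The primes in `(m, N]` that are `1` modulo `4`. -/
noncomputable def primesOneModFour (m N : ℕ) : Finset ℕ :=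
  {p ∈ Ioc m N | p.Prime ∧ p % 4 = 1}

lemma one_add_chi_mul_vonMangoldt_div_le {m n : ℕ} (hm : 2 ≤ m) (hn : m < n) :
    (1 + chi n) * (ArithmeticFunction.vonMangoldt n / n) ≤
      (2 / m) * (if n.Prime ∧ n % 4 = 1 then Real.log n else 0) +
        (2 / m) * (if ¬ n.Prime then ArithmeticFunction.vonMangoldt n else 0) := by
  have hm' : (0 : ℝ) < m := by exact_mod_cast (by omega : 0 < m)
  have hmn : (m : ℝ) < n := by exact_mod_cast hn
  have hL := ArithmeticFunction.vonMangoldt_nonneg (n := n)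
  have h1 : (1 + chi n) * (ArithmeticFunction.vonMangoldt n / n) ≤
      2 / m * ArithmeticFunction.vonMangoldt n := by
    have : 1 + chi n ≤ 2 := by linarith [(abs_le.1 (abs_chi_le_one n)).2]
    calc _ ≤ 2 * (ArithmeticFunction.vonMangoldt n / m) := by gcongr
      _ = _ := by ring
  by_cases hp : n.Prime
  · by_cases h4 : n % 4 = 1
    · simpa [hp, h4, ArithmeticFunction.vonMangoldt_apply_prime hp] using h1
    · have h2 : n % 2 = 1 := (hp.eq_two_or_odd).resolve_left (by omega)
      have : chi n = -1 := by
        rw [chi_eq, if_neg (by omega), if_neg h4]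
      simp [this, hp, h4]
  · simpa [hp] using h1

/-- Chebyshev's lower bound for the primes that are `1` modulo `4`. -/
lemma exists_le_sum_log_primesOneModFour :
    ∃ C₀ m₀ : ℕ, 2 ≤ C₀ ∧ 2 ≤ m₀ ∧ ∀ m, m₀ ≤ m →
      (m : ℝ) ≤ ∑ p ∈ primesOneModFour m (C₀ * m), Real.log p := by
  obtain ⟨C, hC⟩ := exists_log_sub_le_sum_vonMangoldt
  obtain ⟨D, hD⟩ := Chebyshev.psi_sub_theta_le_mul_sqrt
  obtain ⟨C₀, hC₀⟩ := exists_nat_ge (max 2 (Real.exp (C + 4)))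
  have hC₀2 : 2 ≤ C₀ := by exact_mod_cast (le_max_left _ _).trans hC₀
  have hC₀e : C + 4 ≤ Real.log C₀ := by
    rw [Real.le_log_iff_exp_le (by exact_mod_cast (by omega : 0 < C₀))]
    exact (le_max_right _ _).trans hC₀
  obtain ⟨m₀, hm₀⟩ := exists_nat_ge (max 2 (D ^ 2 * C₀))
  have hm₀2 : 2 ≤ m₀ := by exact_mod_cast (le_max_left _ _).trans hm₀
  refine ⟨C₀, m₀, hC₀2, hm₀2, fun m hm ↦ ?_⟩
  have hm' : (0 : ℝ) < m := by exact_mod_cast (by omega : 0 < m)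
  have hC₀' : (0 : ℝ) < C₀ := by exact_mod_cast (by omega : 0 < C₀)
  have h1 := hC m (C₀ * m) (by omega) (Nat.le_mul_of_pos_left m (by omega))
  have h2 := hD ((C₀ * m : ℕ) : ℝ)
  rw [Chebyshev.psi_sub_theta_eq_sum_not_prime, Nat.floor_natCast] at h2
  have h3 : D * √((C₀ * m : ℕ) : ℝ) ≤ m := by
    have h4 : D ^ 2 * C₀ ≤ m := (le_max_right _ _).trans (hm₀.trans (by exact_mod_cast hm))
    refine (le_abs_self _).trans (abs_le_of_sq_le_sq ?_ hm'.le)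
    rw [mul_pow, Real.sq_sqrt (by positivity)]
    push_cast
    nlinarith
  have h4 : ∑ n ∈ Ioc m (C₀ * m), (if ¬ n.Prime then ArithmeticFunction.vonMangoldt n else 0) ≤
      m := by
    refine le_trans ?_ (h2.trans h3)
    rw [sum_filter]
    refine sum_le_sum_of_subset_of_nonneg (Ioc_subset_Ioc_left (Nat.zero_le m)) fun n _ _ ↦ ?_
    split_ifs
    exacts [le_rfl, ArithmeticFunction.vonMangoldt_nonneg]
  have h5 := h1.trans (sum_le_sum fun n hn ↦
    one_add_chi_mul_vonMangoldt_div_le (by omega) (mem_Ioc.1 hn).1)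
  rw [sum_add_distrib, ← mul_sum, ← mul_sum, ← sum_filter] at h5
  push_cast at h5
  rw [Real.log_mul hC₀'.ne' hm'.ne'] at h5
  have h6 : 2 / (m : ℝ) * ∑ n ∈ Ioc m (C₀ * m),
      (if ¬ n.Prime then ArithmeticFunction.vonMangoldt n else 0) ≤ 2 := by
    calc _ ≤ 2 / (m : ℝ) * m := by gcongr
      _ = 2 := by field_simp
  have h7 : 2 ≤ 2 / (m : ℝ) * ∑ p ∈ primesOneModFour m (C₀ * m), Real.log p := by
    unfold primesOneModFour
    linarith
  rw [div_mul_eq_mul_div, le_div_iff₀ hm'] at h7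
  linarith

lemma isSumTwoSquares_iff {n : ℕ} (hn : n ≠ 0) :
    IsSumTwoSquares n ↔ ∀ q, q.Prime → q % 4 = 3 → Even (n.factorization q) := by
  have h1 : IsSumTwoSquares n ↔ ∃ x y : ℕ, n = x ^ 2 + y ^ 2 := by
    constructor
    · rintro ⟨x, y, h⟩
      refine ⟨x.natAbs, y.natAbs, ?_⟩
      zify
      simpa using h
    · rintro ⟨x, y, h⟩
      exact ⟨x, y, by exact_mod_cast h⟩
  rw [h1, Nat.eq_sq_add_sq_iff]
  refine ⟨fun h q hq hq4 ↦ ?_, fun h q hq hq4 ↦ ?_⟩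
  · by_cases hd : q ∣ n
    · rw [Nat.factorization_def n hq]
      exact h q (hq.mem_primeFactors hd hn) hq4
    · rw [Nat.factorization_eq_zero_of_not_dvd hd]
      exact Even.zero
  · have hp := Nat.prime_of_mem_primeFactors hq
    rw [← Nat.factorization_def n hp]
    exact h q hp hq4

lemma isSumTwoSquares_mul_iff {m n : ℕ} (hm : m ≠ 0) (hn : n ≠ 0) (h : m.Coprime n) :
    IsSumTwoSquares (m * n) ↔ IsSumTwoSquares m ∧ IsSumTwoSquares n := by
  rw [isSumTwoSquares_iff hm, isSumTwoSquares_iff hn, isSumTwoSquares_iff (mul_ne_zero hm hn),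
    ← forall_and]
  refine forall_congr' fun q ↦ ?_
  rw [← forall_and]
  refine forall_congr' fun hq ↦ ?_
  rw [← forall_and]
  refine forall_congr' fun _ ↦ ?_
  rw [Nat.factorization_mul hm hn, Finsupp.add_apply]
  by_cases hd : q ∣ m
  · have : ¬ q ∣ n := fun h' ↦ hq.one_lt.ne' (Nat.eq_one_of_dvd_coprimes h hd h')
    simp [Nat.factorization_eq_zero_of_not_dvd this]
  · simp [Nat.factorization_eq_zero_of_not_dvd hd]

lemma IsSumTwoSquares.mul {m n : ℕ} (hm : IsSumTwoSquares m) (hn : IsSumTwoSquares n) :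
    IsSumTwoSquares (m * n) := by
  obtain ⟨x, y, h⟩ := hm
  obtain ⟨z, w, h'⟩ := hn
  exact ⟨x * z - y * w, x * w + y * z, by push_cast; rw [h, h']; ring⟩

lemma isSumTwoSquares_prime_pow {p k : ℕ} (hp : p.Prime) (h : p % 4 = 3 → Even k) :
    IsSumTwoSquares (p ^ k) := by
  rw [isSumTwoSquares_iff (pow_ne_zero _ hp.ne_zero)]
  intro q hq hq4
  rw [hp.factorization_pow, Finsupp.single_apply]
  split_ifs with hpq
  · exact h (hpq ▸ hq4)
  · exact Even.zero

lemma b_of_isSumTwoSquares {n : ℕ} (h : IsSumTwoSquares n) : b n = 1 := if_pos h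

/-- `b` as an arithmetic function, vanishing at `0`. -/
noncomputable def bArith : ArithmeticFunction ℝ :=
  ⟨fun n ↦ if n = 0 then 0 else (b n : ℝ), by simp⟩

/-- `chi` as an arithmetic function. -/
noncomputable def chiArith : ArithmeticFunction ℝ :=
  ⟨chi, by rw [chi_eq]; simp⟩

lemma bArith_apply {n : ℕ} (hn : n ≠ 0) : bArith n = b n := if_neg hn

lemma chiArith_apply (n : ℕ) : chiArith n = chi n := rfl

lemma bArith_nonneg (n : ℕ) : 0 ≤ bArith n := by
  by_cases hn : n = 0
  · simp [hn]
  · rw [bArith_apply hn]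
    positivity

lemma chi_one : chi 1 = 1 := by rw [chi_eq]; norm_num

lemma isMultiplicative_bArith : bArith.IsMultiplicative := by
  rw [ArithmeticFunction.IsMultiplicative.iff_ne_zero]
  refine ⟨?_, fun {m n} hm hn h ↦ ?_⟩
  · rw [bArith_apply one_ne_zero, b_of_isSumTwoSquares ⟨1, 0, by norm_num⟩]
    simp
  · rw [bArith_apply hm, bArith_apply hn, bArith_apply (mul_ne_zero hm hn)]
    simp only [b, isSumTwoSquares_mul_iff hm hn h]
    split_ifs <;> simp_all

lemma isMultiplicative_chiArith : chiArith.IsMultiplicative :=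
  ⟨chi_one, fun {m n} _ ↦ chi_mul m n⟩

lemma chi_pow (p i : ℕ) : chi (p ^ i) = chi p ^ i := by
  induction i with
  | zero => simp [chi_one]
  | succ i ih => rw [pow_succ, chi_mul, ih, pow_succ]

lemma mul_apply_prime_pow (f g : ArithmeticFunction ℝ) {p : ℕ} (hp : p.Prime) (k : ℕ) :
    (f * g) (p ^ k) = ∑ i ∈ range (k + 1), f (p ^ i) * g (p ^ (k - i)) := by
  rw [ArithmeticFunction.mul_apply, Nat.sum_divisorsAntidiagonal (fun i j ↦ f i * g j),
    Nat.sum_divisors_prime_pow hp]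
  refine sum_congr rfl fun i hi ↦ ?_
  rw [Nat.pow_div (by simpa [Nat.lt_succ_iff] using hi) hp.pos]

open ArithmeticFunction in
lemma chiArith_mul_zeta_prime_pow_le {p : ℕ} (hp : p.Prime) (k : ℕ) :
    0 ≤ (chiArith * (zeta : ArithmeticFunction ℝ)) (p ^ k) ∧
      (chiArith * (zeta : ArithmeticFunction ℝ)) (p ^ k) ≤ (bArith * bArith) (p ^ k) := by
  have hpi : ∀ i, p ^ i ≠ 0 := fun i ↦ pow_ne_zero _ hp.ne_zero
  have hb : ∀ i, (p % 4 = 3 → Even i) → bArith (p ^ i) = 1 := fun i hi ↦ by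
    rw [bArith_apply (hpi i), b_of_isSumTwoSquares (isSumTwoSquares_prime_pow hp hi)]
    simp
  have h1 : (chiArith * (zeta : ArithmeticFunction ℝ)) (p ^ k) =
      ∑ i ∈ range (k + 1), chi p ^ i := by
    rw [mul_apply_prime_pow _ _ hp]
    refine sum_congr rfl fun i _ ↦ ?_
    rw [chiArith_apply, chi_pow, natCoe_apply, zeta_apply_ne (hpi _)]
    simp
  have h0 : 0 ≤ (bArith * bArith) (p ^ k) := by
    rw [mul_apply]
    exact sum_nonneg fun x _ ↦ mul_nonneg (bArith_nonneg _) (bArith_nonneg _)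
  have h2 : (p % 4 = 3 → Even k) → 1 ≤ (bArith * bArith) (p ^ k) := fun h ↦ by
    rw [mul_apply_prime_pow _ _ hp]
    refine le_trans ?_ (single_le_sum (fun i _ ↦ mul_nonneg (bArith_nonneg _) (bArith_nonneg _))
      (mem_range.2 (Nat.succ_pos k)))
    rw [hb 0 (fun _ ↦ Even.zero), Nat.sub_zero, hb k h]
    norm_num
  rw [h1]
  obtain rfl | hodd := hp.eq_two_or_odd
  · have : chi 2 = 0 := by rw [chi_eq]; norm_num
    have h3 : ∑ i ∈ range (k + 1), chi 2 ^ i = 1 := by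
      rw [sum_range_succ', this]
      simp
    rw [h3]
    exact ⟨zero_le_one, h2 (by norm_num)⟩
  · by_cases h4 : p % 4 = 1
    · have : chi p = 1 := by rw [chi_eq, if_neg (by omega), if_pos h4]
      rw [this, mul_apply_prime_pow _ _ hp]
      refine ⟨by positivity, sum_le_sum fun i _ ↦ ?_⟩
      rw [hb _ (by omega), hb _ (by omega)]
      norm_num
    · have : chi p = -1 := by rw [chi_eq, if_neg (by omega), if_neg h4]
      rw [this, neg_one_geom_sum]
      split_ifs with hk
      · exact ⟨le_rfl, h0⟩
      · refine ⟨zero_le_one, h2 fun _ ↦ ?_⟩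
        rw [Nat.even_add_one, not_not] at hk
        exact hk

open ArithmeticFunction in
lemma chiArith_mul_zeta_le {n : ℕ} :
    0 ≤ (chiArith * (zeta : ArithmeticFunction ℝ)) n ∧
      (chiArith * (zeta : ArithmeticFunction ℝ)) n ≤ (bArith * bArith) n := by
  have hf : (chiArith * (zeta : ArithmeticFunction ℝ)).IsMultiplicative :=
    isMultiplicative_chiArith.mul isMultiplicative_zeta.natCast
  have hg : (bArith * bArith).IsMultiplicative :=
    isMultiplicative_bArith.mul isMultiplicative_bArith
  induction n using Nat.recOnPosPrimePosCoprime with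
  | prime_pow p k hp _ => exact chiArith_mul_zeta_prime_pow_le hp k
  | zero => simp
  | one => simp [hf.map_one, hg.map_one]
  | coprime m n _ _ h hm hn =>
    rw [hf.map_mul_of_coprime h, hg.map_mul_of_coprime h]
    exact ⟨mul_nonneg hm.1 hn.1, mul_le_mul hm.2 hn.2 hn.1 (hm.1.trans hm.2)⟩

lemma sum_chi_le_sum_b_mul_b (n : ℕ) :
    ∑ x ∈ n.divisorsAntidiagonal, chi x.1 ≤
      ∑ x ∈ n.divisorsAntidiagonal, (b x.1 : ℝ) * b x.2 := by
  have h := (chiArith_mul_zeta_le (n := n)).2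
  rw [ArithmeticFunction.mul_apply, ArithmeticFunction.mul_apply] at h
  convert h using 1 <;> refine sum_congr rfl fun x hx ↦ ?_
  · rw [chiArith_apply, ArithmeticFunction.natCoe_apply, ArithmeticFunction.zeta_apply_ne
      (Nat.ne_zero_of_mem_divisorsAntidiagonal hx).2]
    simp
  · rw [bArith_apply (Nat.ne_zero_of_mem_divisorsAntidiagonal hx).1,
      bArith_apply (Nat.ne_zero_of_mem_divisorsAntidiagonal hx).2]

lemma two_thirds_log_le_sq_sum_b_div (N : ℕ) :
    2 / 3 * Real.log N ≤ (∑ n ∈ Ioc 0 N, (b n : ℝ) / n) ^ 2 := by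
  obtain rfl | hN := Nat.eq_zero_or_pos N
  · simp
  set H : ℕ → ℝ := fun m ↦ ∑ n ∈ Ioc 0 m, 1 / (n : ℝ) with hH
  have hHmono : ∀ {m n}, m ≤ n → H m ≤ H n := fun h ↦
    sum_le_sum_of_subset_of_nonneg (Ioc_subset_Ioc_right h) fun _ _ _ ↦ by positivity
  have hH0 : ∀ m, 0 ≤ H m := fun m ↦ sum_nonneg fun _ _ ↦ by positivity
  have hHlog : Real.log N ≤ H N := by
    have h1 := log_add_one_le_harmonic N
    have h2 : ((harmonic N : ℚ) : ℝ) = H N := by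
      rw [harmonic_eq_sum_Icc, hH]
      push_cast
      exact sum_congr (by ext; simp; omega) fun n _ ↦ by simp
    rw [h2] at h1
    refine le_trans (Real.log_le_log (by exact_mod_cast hN) ?_) h1
    push_cast
    linarith
  have h1 : 2 / 3 * H N ≤ ∑ d ∈ Ioc 0 N, chi d * (H (N / d) / d) := by
    have := le_sum_chi_mul (f := fun d ↦ H (N / d) / d)
      (fun d hd ↦ by
        have : (0 : ℝ) < d := by exact_mod_cast (by omega : 0 < d)
        have h1 := hHmono (Nat.div_le_div_left (a := N) d.le_succ (by omega))
        have h2 := hH0 (N / d)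
        push_cast
        gcongr
        linarith)
      (fun d _ ↦ div_nonneg (hH0 _) (by positivity)) hN
    have h2 := hHmono (Nat.div_le_self N 3)
    norm_num at this
    linarith
  have h2 : ∑ d ∈ Ioc 0 N, chi d * (H (N / d) / d) =
      ∑ n ∈ Ioc 0 N, (∑ x ∈ n.divisorsAntidiagonal, chi x.1) / n := by
    have := sum_Ioc_sum_divisorsAntidiagonal (fun d ↦ chi d / d) (fun m ↦ 1 / m) N
    convert this.symm using 1
    · exact sum_congr rfl fun d _ ↦ by simp only [hH]; ring
    · refine sum_congr rfl fun n _ ↦ ?_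
      rw [sum_div]
      refine sum_congr rfl fun x hx ↦ ?_
      rw [← (Nat.mem_divisorsAntidiagonal.1 hx).1]
      push_cast
      rw [div_mul_div_comm, mul_one]
  have h3 : ∑ n ∈ Ioc 0 N, (∑ x ∈ n.divisorsAntidiagonal, chi x.1) / n ≤
      ∑ n ∈ Ioc 0 N, ∑ x ∈ n.divisorsAntidiagonal, ((b x.1 : ℝ) / x.1) * (b x.2 / x.2) := by
    refine sum_le_sum fun n _ ↦ ?_
    have : ∑ x ∈ n.divisorsAntidiagonal, ((b x.1 : ℝ) / x.1) * (b x.2 / x.2) =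
        (∑ x ∈ n.divisorsAntidiagonal, (b x.1 : ℝ) * b x.2) / n := by
      rw [sum_div]
      refine sum_congr rfl fun x hx ↦ ?_
      rw [← (Nat.mem_divisorsAntidiagonal.1 hx).1]
      push_cast
      rw [div_mul_div_comm]
    rw [this]
    have := sum_chi_le_sum_b_mul_b n
    gcongr
  rw [sum_Ioc_sum_divisorsAntidiagonal (fun d ↦ (b d : ℝ) / d) (fun d ↦ (b d : ℝ) / d)] at h3
  have h4 : ∑ d ∈ Ioc 0 N, (b d : ℝ) / d * ∑ m ∈ Ioc 0 (N / d), (b m : ℝ) / m ≤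
      (∑ n ∈ Ioc 0 N, (b n : ℝ) / n) ^ 2 := by
    rw [sq, sum_mul]
    refine sum_le_sum fun d _ ↦ mul_le_mul_of_nonneg_left ?_ (by positivity)
    exact sum_le_sum_of_subset_of_nonneg (Ioc_subset_Ioc_right (Nat.div_le_self _ _))
      fun _ _ _ ↦ by positivity
  linarith

lemma b_le_b_mul {m p : ℕ} (hp : p.Prime) (hp4 : p % 4 = 1) : b m ≤ b (m * p) := by
  unfold b
  split_ifs with h1 h2 <;> try omega
  refine absurd (h1.mul ?_) h2
  simpa using isSumTwoSquares_prime_pow (k := 1) hp (by omega)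

lemma sum_log_primeFactors_le_log (n : ℕ) : ∑ p ∈ n.primeFactors, Real.log p ≤ Real.log n := by
  obtain rfl | hn := Nat.eq_zero_or_pos n
  · simp
  rw [← Real.log_prod (fun p hp ↦ by exact_mod_cast (Nat.prime_of_mem_primeFactors hp).ne_zero)]
  refine Real.log_le_log (prod_pos fun p hp ↦ by
    exact_mod_cast (Nat.prime_of_mem_primeFactors hp).pos) ?_
  rw [← Nat.cast_prod]
  exact_mod_cast Nat.le_of_dvd hn (Nat.prod_primeFactors_dvd n)

lemma sum_le_sum_of_injOn_le {α β : Type*} {s : Finset α} {t : Finset β} {f : α → ℝ} {g : β → ℝ}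
    (e : α → β) (he : Set.InjOn e s) (hst : ∀ a ∈ s, e a ∈ t) (hfg : ∀ a ∈ s, f a ≤ g (e a))
    (hg : ∀ x ∈ t, 0 ≤ g x) : ∑ a ∈ s, f a ≤ ∑ x ∈ t, g x := by
  calc ∑ a ∈ s, f a ≤ ∑ a ∈ s, g (e a) := sum_le_sum hfg
    _ = ∑ x ∈ s.image e, g x := (sum_image he).symm
    _ ≤ ∑ x ∈ t, g x := sum_le_sum_of_subset_of_nonneg (image_subset_iff.2 hst)
        fun x hx _ ↦ hg x hx

/-- Removing one prime factor `p ≡ 1 [MOD 4]` in a logarithmically weighted count of sums of two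
squares. -/
lemma sum_b_mul_sum_log_le (x C y : ℕ) :
    ∑ m ∈ Ioc 0 (x / y), (b m : ℝ) * ∑ p ∈ primesOneModFour (x / m) (C * (x / m)), Real.log p ≤
      ∑ n ∈ Ioc x (C * x), (b n : ℝ) * Real.log n := by
  have h1 : ∑ n ∈ Ioc x (C * x), (b n : ℝ) * ∑ p ∈ n.primeFactors, Real.log p ≤
      ∑ n ∈ Ioc x (C * x), (b n : ℝ) * Real.log n :=
    sum_le_sum fun n _ ↦ mul_le_mul_of_nonneg_left (sum_log_primeFactors_le_log n) (by positivity)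
  refine le_trans ?_ h1
  simp_rw [mul_sum]
  rw [sum_sigma', sum_sigma']
  have hS : ∀ a ∈ (Ioc 0 (x / y)).sigma fun m ↦ primesOneModFour (x / m) (C * (x / m)),
      0 < a.1 ∧ a.2.Prime ∧ a.2 % 4 = 1 ∧ x < a.1 * a.2 ∧ a.1 * a.2 ≤ C * x := by
    intro a ha
    obtain ⟨ha1, ha2⟩ := mem_sigma.1 ha
    obtain ⟨ha2, hp, hp4⟩ := mem_filter.1 ha2
    obtain ⟨ha2, ha3⟩ := mem_Ioc.1 ha2
    have h0 := (mem_Ioc.1 ha1).1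
    refine ⟨h0, hp, hp4, ?_, ?_⟩
    · rw [mul_comm]
      exact (Nat.div_lt_iff_lt_mul h0).1 ha2
    · calc a.1 * a.2 ≤ a.1 * (C * (x / a.1)) := Nat.mul_le_mul_left _ ha3
        _ = C * (a.1 * (x / a.1)) := by ring
        _ ≤ C * x := Nat.mul_le_mul_left _ (Nat.mul_div_le x a.1)
  refine sum_le_sum_of_injOn_le (fun a ↦ ⟨a.1 * a.2, a.2⟩) ?_ ?_ ?_ ?_
  · rintro ⟨m, p⟩ ha ⟨m', p'⟩ ha' h
    simp only [Sigma.mk.injEq, heq_eq_eq] at h ⊢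
    obtain ⟨h1, rfl⟩ := h
    exact ⟨Nat.eq_of_mul_eq_mul_right (hS _ ha).2.1.pos h1, rfl⟩
  · intro a ha
    obtain ⟨h0, hp, hp4, h1, h2⟩ := hS a ha
    refine mem_sigma.2 ⟨mem_Ioc.2 ⟨h1, h2⟩, hp.mem_primeFactors (dvd_mul_left _ _) ?_⟩
    exact (mul_pos h0 hp.pos).ne'
  · intro a ha
    obtain ⟨_, hp, hp4, _, _⟩ := hS a ha
    refine mul_le_mul_of_nonneg_right ?_ (Real.log_natCast_nonneg _)
    exact_mod_cast b_le_b_mul hp hp4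
  · intro a _
    exact mul_nonneg (Nat.cast_nonneg _) (Real.log_natCast_nonneg _)

/-- The lower bound in Landau's theorem on sums of two squares, in intervals `(x, C x]`. -/
lemma exists_le_card_isSumTwoSquares :
    ∃ c : ℝ, 0 < c ∧ ∃ C : ℕ, 2 ≤ C ∧ ∀ᶠ x : ℕ in atTop,
      c * x / √(Real.log x) ≤ #{n ∈ Ioc x (C * x) | IsSumTwoSquares n} := by
  obtain ⟨C, y, hC, hy, hCy⟩ := exists_le_sum_log_primesOneModFour
  refine ⟨1 / 8, by norm_num, C, hC, ?_⟩
  filter_upwards [eventually_ge_atTop (16 * y ^ 4), eventually_ge_atTop C] with x hx hxC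
  have hy0 : 0 < y := by omega
  have hyy : y ≤ y ^ 4 := Nat.le_self_pow (by norm_num) y
  have hx2 : 2 ≤ x := by omega
  have hx0 : (0 : ℝ) < x := by exact_mod_cast (by omega : 0 < x)
  have hL : 0 < Real.log x := Real.log_pos (by exact_mod_cast (by omega : 1 < x))
  have hsq : 0 < √(Real.log x) := Real.sqrt_pos.2 hL
  have hsq2 : √(Real.log x) * √(Real.log x) = Real.log x := Real.mul_self_sqrt hL.le
  set F := ∑ m ∈ Ioc 0 (x / y), (b m : ℝ) / m with hF
  have hF0 : 0 ≤ F := sum_nonneg fun _ _ ↦ by positivity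
  have h1 : x / 2 * F ≤ ∑ n ∈ Ioc x (C * x), (b n : ℝ) * Real.log n := by
    refine le_trans ?_ (sum_b_mul_sum_log_le x C y)
    rw [hF, mul_sum]
    refine sum_le_sum fun m hm ↦ ?_
    obtain ⟨hm0, hmx⟩ := mem_Ioc.1 hm
    have hm0' : (0 : ℝ) < m := by exact_mod_cast hm0
    have hym : y ≤ x / m := by
      rw [Nat.le_div_iff_mul_le hm0, mul_comm]
      exact (Nat.le_div_iff_mul_le hy0).1 hmx
    have h2 : (x : ℝ) / m ≤ 2 * ((x / m : ℕ) : ℝ) := by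
      have h3 : (x : ℝ) / m ≤ ((x / m : ℕ) : ℝ) + 1 := by
        rw [← Nat.floor_div_eq_div (K := ℝ)]
        exact (Nat.lt_floor_add_one _).le
      have : (1 : ℝ) ≤ ((x / m : ℕ) : ℝ) := by exact_mod_cast (by omega)
      linarith
    calc (x : ℝ) / 2 * (b m / m) = b m * ((x / m) / 2) := by ring
      _ ≤ b m * ((x / m : ℕ) : ℝ) := by gcongr; linarith
      _ ≤ _ := by gcongr; exact hCy _ hym
  have h2 : √(Real.log x) / 2 ≤ F := by
    refine abs_le_of_sq_le_sq' ?_ hF0 |>.2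
    refine le_trans ?_ (two_thirds_log_le_sq_sum_b_div (x / y))
    have h3 : 3 / 4 * Real.log x ≤ Real.log ((x / y : ℕ) : ℝ) := by
      have h4 : x ^ 3 ≤ (x / y) ^ 4 := by
        have h5 : x ≤ 2 * y * (x / y) := by
          have := Nat.div_add_mod x y
          have := Nat.mod_lt x hy0
          have : 1 ≤ x / y := (Nat.one_le_div_iff hy0).2 (by omega)
          nlinarith
        have h6 : x * x ^ 3 ≤ x * (x / y) ^ 4 :=
          calc x * x ^ 3 = x ^ 4 := by ring
            _ ≤ (2 * y * (x / y)) ^ 4 := Nat.pow_le_pow_left h5 4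
            _ = 16 * y ^ 4 * (x / y) ^ 4 := by ring
            _ ≤ _ := Nat.mul_le_mul_right _ hx
        exact Nat.le_of_mul_le_mul_left h6 (by omega)
      have h5 := Real.log_le_log (by positivity) (show (x : ℝ) ^ 3 ≤ ((x / y : ℕ) : ℝ) ^ 4 by
        exact_mod_cast h4)
      rw [Real.log_pow, Real.log_pow] at h5
      push_cast at h5
      linarith
    rw [div_pow, sq, hsq2]
    linarith
  have h3 : ∑ n ∈ Ioc x (C * x), (b n : ℝ) * Real.log n ≤
      #{n ∈ Ioc x (C * x) | IsSumTwoSquares n} * (2 * Real.log x) := by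
    rw [← nsmul_eq_mul, ← sum_const, sum_filter]
    refine sum_le_sum fun n hn ↦ ?_
    unfold b
    split_ifs with hb
    · have h4 : (n : ℝ) ≤ x ^ 2 := by
        have := (mem_Ioc.1 hn).2
        exact_mod_cast this.trans (by nlinarith)
      have h5 := Real.log_le_log (by exact_mod_cast (by have := (mem_Ioc.1 hn).1; omega)) h4
      rw [Real.log_pow] at h5
      simpa using h5
    · simp
  rw [div_le_iff₀ hsq]
  have h4 : x / 2 * (√(Real.log x) / 2) ≤
      #{n ∈ Ioc x (C * x) | IsSumTwoSquares n} * (2 * Real.log x) :=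
    (mul_le_mul_of_nonneg_left h2 (by positivity)).trans (h1.trans h3)
  refine le_of_mul_le_mul_right ?_ hsq
  rw [mul_assoc _ √(Real.log x), hsq2]
  linarith

lemma exists_le_card_isSumTwoSquares_short :
    ∃ c : ℝ, 0 < c ∧ ∃ C : ℕ, 2 ≤ C ∧ ∀ᶠ x : ℕ in atTop,
      ∃ (y : ℕ) (A : Finset ℕ), x ≤ y ∧ y ≤ C * x ∧
        (∀ n ∈ A, IsSumTwoSquares n ∧ y < n ∧ 10 * n ≤ 11 * y) ∧
        c * x / √(Real.log x) ≤ #A := by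
  obtain ⟨c, hc, C, hC, hx⟩ := exists_le_card_isSumTwoSquares
  refine ⟨c / (20 * C + 1), by positivity, 2 * C + 1, by omega, ?_⟩
  filter_upwards [hx, eventually_ge_atTop 20] with x hx hx20
  set h := x / 10 with hh
  have hx20h : x ≤ 20 * h := by omega
  have hh0 : 0 < h := by omega
  have hmaps : ∀ n ∈ ({n ∈ Ioc x (C * x) | IsSumTwoSquares n} : Finset ℕ),
      (n - x - 1) / h ∈ range (20 * C + 1) := by
    intro n hn
    have := (mem_Ioc.1 (mem_filter.1 hn).1).2
    rw [mem_range, Nat.div_lt_iff_lt_mul hh0]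
    have : C * x ≤ C * (20 * h) := Nat.mul_le_mul_left _ hx20h
    nlinarith [Nat.sub_le n x, Nat.sub_le (n - x) 1]
  obtain ⟨j, hj, hcard⟩ := exists_le_card_fiber_of_nsmul_le_card_of_maps_to
    (b := c / (20 * C + 1) * x / √(Real.log x)) hmaps ⟨0, by simp⟩ (by
      refine le_trans (le_of_eq ?_) hx
      rw [card_range, nsmul_eq_mul]
      push_cast
      field_simp)
  refine ⟨x + j * h, _, by omega, ?_, fun n hn ↦ ?_, hcard⟩
  · have h1 : j ≤ 20 * C := by simpa [Nat.lt_succ_iff] using hj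
    have h2 : j * h ≤ 20 * C * h := Nat.mul_le_mul_right _ h1
    have h3 : 10 * h ≤ x := by omega
    have h4 : C * (10 * h) ≤ C * x := Nat.mul_le_mul_left _ h3
    nlinarith
  · obtain ⟨hn, hnj⟩ := mem_filter.1 hn
    obtain ⟨hn, hb⟩ := mem_filter.1 hn
    have hxn := (mem_Ioc.1 hn).1
    have h1 := Nat.div_mul_le_self (n - x - 1) h
    have h2 := Nat.lt_div_mul_add (a := n - x - 1) hh0
    rw [hnj] at h1 h2
    refine ⟨hb, by omega, by omega⟩

lemma sum_range_mul_mod (f : ℕ → ℝ) (p t : ℕ) :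
    ∑ m ∈ range (p * t), f (m % p) = t * ∑ a ∈ range p, f a := by
  induction t with
  | zero => simp
  | succ t ih =>
    rw [mul_add_one, sum_range_add, ih]
    have : ∑ x ∈ range p, f ((p * t + x) % p) = ∑ x ∈ range p, f x :=
      sum_congr rfl fun x hx ↦ by
        rw [Nat.mul_add_mod, Nat.mod_eq_of_lt (mem_range.1 hx)]
    rw [this]
    push_cast
    ring

lemma sum_range_mul_mod_mod (f g : ℕ → ℝ) {p q : ℕ} (hp : p ≠ 0) (hq : q ≠ 0)
    (hpq : p.Coprime q) (t : ℕ) :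
    ∑ m ∈ range (p * q * t), f (m % p) * g (m % q) =
      t * ((∑ a ∈ range p, f a) * ∑ a ∈ range q, g a) := by
  have h1 := sum_range_mul_mod (fun m ↦ f (m % p) * g (m % q)) (p * q) t
  simp only [Nat.mod_mul_right_mod, Nat.mod_mul_left_mod] at h1
  rw [h1, sum_mul_sum, ← sum_product']
  congr 1
  refine sum_nbij (fun m ↦ (m % p, m % q)) ?_ ?_ ?_ ?_
  · intro m _
    simp [Nat.mod_lt, Nat.pos_of_ne_zero hp, Nat.pos_of_ne_zero hq]
  · intro m hm n hn h
    simp only [Prod.mk.injEq] at h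
    have h2 : m ≡ n [MOD p * q] := (Nat.modEq_and_modEq_iff_modEq_mul hpq).1 h
    exact h2.eq_of_lt_of_lt (by simpa using hm) (by simpa using hn)
  · rintro ⟨a, d⟩ h
    simp only [coe_product, Set.mem_prod, mem_coe, mem_range] at h
    refine ⟨Nat.chineseRemainder hpq a d, ?_, ?_⟩
    · simpa using Nat.chineseRemainder_lt_mul hpq a d hp hq
    · simp only [Prod.mk.injEq]
      exact ⟨Eq.trans (Nat.chineseRemainder hpq a d).2.1 (Nat.mod_eq_of_lt h.1),
        Eq.trans (Nat.chineseRemainder hpq a d).2.2 (Nat.mod_eq_of_lt h.2)⟩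
  · intro m _
    rfl

/-- The deviation of the number of elements of `A` in the class `a` modulo `p` from its mean. -/
noncomputable def residueDeviation (A : Finset ℕ) (p a : ℕ) : ℝ :=
  (#{m ∈ A | m % p = a} : ℝ) - #A / p

lemma sum_card_filter_mod_mul (A : Finset ℕ) {p : ℕ} (hp : 0 < p) (f : ℕ → ℝ) :
    ∑ a ∈ range p, (#{m ∈ A | m % p = a} : ℝ) * f a = ∑ m ∈ A, f (m % p) := by
  rw [← sum_fiberwise_of_maps_to (s := A) (f := fun m ↦ f (m % p)) (g := fun m ↦ m % p)
    (t := range p) (fun m _ ↦ mem_range.2 (Nat.mod_lt m hp))]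
  refine sum_congr rfl fun a _ ↦ ?_
  rw [← nsmul_eq_mul, ← sum_const]
  exact sum_congr rfl fun m hm ↦ by rw [(mem_filter.1 hm).2]

lemma sum_residueDeviation (A : Finset ℕ) {p : ℕ} (hp : 0 < p) :
    ∑ a ∈ range p, residueDeviation A p a = 0 := by
  have := sum_card_filter_mod_mul A hp 1
  have hp' : (p : ℝ) ≠ 0 := by exact_mod_cast hp.ne'
  simp only [Pi.one_apply, mul_one, sum_const, nsmul_eq_mul] at this
  simp only [residueDeviation, sum_sub_distrib, this, sum_const, card_range, nsmul_eq_mul]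
  field_simp
  ring

lemma sum_card_filter_mod_mul_card (A B : Finset ℕ) {p : ℕ} (hp : 0 < p) :
    ∑ a ∈ range p, (#{m ∈ A | m % p = a} : ℝ) * #{m ∈ B | m % p = a} =
      #A * #B / p + ∑ a ∈ range p, residueDeviation A p a * residueDeviation B p a := by
  have hp' : (p : ℝ) ≠ 0 := by exact_mod_cast hp.ne'
  have h : ∀ a, (#{m ∈ A | m % p = a} : ℝ) * #{m ∈ B | m % p = a} =
      #A * #B / (p * p) + #A / p * residueDeviation B p a + #B / p * residueDeviation A p a +
        residueDeviation A p a * residueDeviation B p a := by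
    intro a
    unfold residueDeviation
    field_simp
    ring
  simp_rw [h]
  rw [sum_add_distrib, sum_add_distrib, sum_add_distrib, ← mul_sum, ← mul_sum,
    sum_residueDeviation A hp, sum_residueDeviation B hp]
  simp
  field_simp

/-- A large sieve inequality for prime moduli dividing the length of the interval. -/
lemma sum_sq_residueDeviation_le {P A : Finset ℕ} {W Q : ℕ} (hP : ∀ p ∈ P, p.Prime)
    (hW : ∀ p ∈ P, p ∣ W) (hQ : 0 < Q) (hQP : ∀ p ∈ P, Q ≤ p) (hA : A ⊆ range W) :
    ∑ p ∈ P, ∑ a ∈ range p, residueDeviation A p a ^ 2 ≤ #A * (W / Q : ℝ) := by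
  set V := ∑ p ∈ P, ∑ a ∈ range p, residueDeviation A p a ^ 2 with hV
  have hV0 : 0 ≤ V := sum_nonneg fun _ _ ↦ sum_nonneg fun _ _ ↦ sq_nonneg _
  set h : ℕ → ℝ := fun m ↦ ∑ p ∈ P, residueDeviation A p (m % p) with hh
  have h1 : V = ∑ m ∈ A, h m := by
    rw [hh, sum_comm]
    refine sum_congr rfl fun p hp ↦ ?_
    have hp0 := (hP p hp).pos
    rw [← sum_card_filter_mod_mul A hp0]
    have : ∀ a, residueDeviation A p a ^ 2 = (#{m ∈ A | m % p = a} : ℝ) * residueDeviation A p a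
        - #A / p * residueDeviation A p a := fun a ↦ by
      rw [← sub_mul, sq]
      rfl
    simp_rw [this]
    rw [sum_sub_distrib, ← mul_sum, sum_residueDeviation A hp0, mul_zero, sub_zero]
  have h2 : ∑ m ∈ range W, h m ^ 2 ≤ W / Q * V := by
    have h3 : ∀ p ∈ P, ∀ q ∈ P, ∑ m ∈ range W,
        residueDeviation A p (m % p) * residueDeviation A q (m % q) =
        if p = q then (W / p : ℝ) * ∑ a ∈ range p, residueDeviation A p a ^ 2 else 0 := by
      intro p hp q hq
      have hp0 := (hP p hp).pos
      split_ifs with hpq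
      · subst hpq
        obtain ⟨t, rfl⟩ := hW p hp
        have hp' : (p : ℝ) ≠ 0 := by exact_mod_cast hp0.ne'
        have := sum_range_mul_mod (fun a ↦ residueDeviation A p a ^ 2) p t
        push_cast
        rw [mul_div_cancel_left₀ _ hp', ← this]
        simp only [sq]
      · have hco := (Nat.coprime_primes (hP p hp) (hP q hq)).2 hpq
        obtain ⟨t, rfl⟩ := hco.mul_dvd_of_dvd_of_dvd (hW p hp) (hW q hq)
        rw [sum_range_mul_mod_mod (residueDeviation A p) (residueDeviation A q) hp0.ne'
          (hP q hq).ne_zero hco, sum_residueDeviation A hp0]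
        simp
    calc ∑ m ∈ range W, h m ^ 2
        = ∑ p ∈ P, ∑ q ∈ P, ∑ m ∈ range W,
            residueDeviation A p (m % p) * residueDeviation A q (m % q) := by
          simp only [hh, sq, sum_mul_sum]
          rw [sum_comm]
          exact sum_congr rfl fun p _ ↦ sum_comm
      _ = ∑ p ∈ P, (W / p : ℝ) * ∑ a ∈ range p, residueDeviation A p a ^ 2 := by
          refine sum_congr rfl fun p hp ↦ ?_
          rw [sum_congr rfl (h3 p hp), sum_ite_eq, if_pos hp]
      _ ≤ ∑ p ∈ P, (W / Q : ℝ) * ∑ a ∈ range p, residueDeviation A p a ^ 2 := by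
          refine sum_le_sum fun p hp ↦ mul_le_mul_of_nonneg_right ?_
            (sum_nonneg fun _ _ ↦ sq_nonneg _)
          have : (Q : ℝ) ≤ p := by exact_mod_cast hQP p hp
          have : (0 : ℝ) < Q := by exact_mod_cast hQ
          gcongr
      _ = W / Q * V := by rw [← mul_sum]
  have h3 : V ^ 2 ≤ #A * (W / Q * V) := by
    calc V ^ 2 = (∑ m ∈ A, h m) ^ 2 := by rw [h1]
      _ ≤ #A * ∑ m ∈ A, h m ^ 2 := sq_sum_le_card_mul_sum_sq
      _ ≤ #A * ∑ m ∈ range W, h m ^ 2 := by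
          gcongr
      _ ≤ _ := by gcongr
  obtain hV0 | hV0 := hV0.eq_or_lt
  · rw [← hV0]
    positivity
  · refine le_of_mul_le_mul_right ?_ hV0
    linarith

/-- Bilinear form of the large sieve: a lower bound for the number of pairs of elements of `A` and
`B` that are congruent modulo the primes in `P`. -/
lemma le_sum_card_filter_mod_eq {P A B : Finset ℕ} {W Q : ℕ} (hP : ∀ p ∈ P, p.Prime)
    (hW : ∀ p ∈ P, p ∣ W) (hQ : 0 < Q) (hQP : ∀ p ∈ P, Q ≤ p) (hA : A ⊆ range W)
    (hB : B ⊆ range W) (hAB : #A = #B) :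
    (#A : ℝ) ^ 2 * ∑ p ∈ P, 1 / (p : ℝ) - #A * (W / Q : ℝ) ≤
      ∑ p ∈ P, (#{x ∈ A ×ˢ B | x.1 % p = x.2 % p} : ℝ) := by
  have h1 : ∀ p ∈ P, (#{x ∈ A ×ˢ B | x.1 % p = x.2 % p} : ℝ) =
      (#A : ℝ) ^ 2 * (1 / p) +
        ∑ a ∈ range p, residueDeviation A p a * residueDeviation B p a := by
    intro p hp
    have h2 := sum_card_filter_mod_mul_card A B (hP p hp).pos
    rw [← hAB] at h2
    rw [show (#A : ℝ) ^ 2 * (1 / p) = #A * #A / p by ring, ← h2]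
    have h3 : ∀ x ∈ ({x ∈ A ×ˢ B | x.1 % p = x.2 % p} : Finset (ℕ × ℕ)), x.1 % p ∈ range p :=
      fun x _ ↦ mem_range.2 (Nat.mod_lt _ (hP p hp).pos)
    rw [card_eq_sum_card_fiberwise h3]
    push_cast
    refine sum_congr rfl fun a _ ↦ ?_
    rw [← Nat.cast_mul, ← card_product]
    congr 2
    ext x
    simp only [mem_filter, mem_product]
    constructor
    · rintro ⟨⟨⟨h1, h2⟩, h3⟩, h4⟩
      exact ⟨⟨h1, h4⟩, h2, h3 ▸ h4⟩
    · rintro ⟨⟨h1, h4⟩, h2, h3⟩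
      exact ⟨⟨⟨h1, h2⟩, h4.trans h3.symm⟩, h4⟩
  rw [sum_congr rfl h1, sum_add_distrib, ← mul_sum]
  have hVA := sum_sq_residueDeviation_le hP hW hQ hQP hA
  have hVB := sum_sq_residueDeviation_le hP hW hQ hQP hB
  rw [← hAB] at hVB
  have h4 : -((∑ p ∈ P, ∑ a ∈ range p, residueDeviation A p a ^ 2 +
      ∑ p ∈ P, ∑ a ∈ range p, residueDeviation B p a ^ 2) / 2) ≤
      ∑ p ∈ P, ∑ a ∈ range p, residueDeviation A p a * residueDeviation B p a := by
    rw [← sum_add_distrib, sum_div, ← sum_neg_distrib]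
    refine sum_le_sum fun p _ ↦ ?_
    rw [← sum_add_distrib, sum_div, ← sum_neg_distrib]
    refine sum_le_sum fun a _ ↦ ?_
    nlinarith [sq_nonneg (residueDeviation A p a + residueDeviation B p a)]
  linarith

lemma card_filter_mod_eq_le_sum {A B : Finset ℕ} {M N p : ℕ} (hp : 0 < p)
    (hA : ∀ v ∈ A, IsSumTwoSquares v ∧ 1 ≤ v ∧ v ≤ N) (hB : ∀ w ∈ B, IsSumTwoSquares w)
    (hAB : ∀ v ∈ A, ∀ w ∈ B, v + M * p ≤ w ∧ w < v + 2 * M * p) :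
    (#{x ∈ A ×ˢ B | x.1 % p = x.2 % p} : ℝ) ≤
      ∑ n ∈ Ico M (2 * M), ∑ m ∈ Icc 1 N, (b m * b (m + n * p) : ℝ) := by
  rw [← sum_product' (f := fun n m ↦ (b m * b (m + n * p) : ℝ)), card_eq_sum_ones, Nat.cast_sum]
  have hS : ∀ x ∈ ({x ∈ A ×ˢ B | x.1 % p = x.2 % p} : Finset (ℕ × ℕ)),
      x.1 ∈ A ∧ x.2 ∈ B ∧ x.1 + (x.2 - x.1) / p * p = x.2 := by
    intro x hx
    simp only [mem_filter, mem_product] at hx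
    obtain ⟨⟨hv, hw⟩, h⟩ := hx
    have hle : x.1 ≤ x.2 := le_trans (Nat.le_add_right _ _) (hAB _ hv _ hw).1
    rw [Nat.div_mul_cancel ((Nat.modEq_iff_dvd' hle).1 h)]
    exact ⟨hv, hw, by omega⟩
  refine sum_le_sum_of_injOn_le (fun x ↦ ((x.2 - x.1) / p, x.1)) ?_ ?_ ?_ ?_
  · intro x hx x' hx' h
    simp only [Prod.mk.injEq] at h
    have h1 := (hS x hx).2.2
    have h2 := (hS x' hx').2.2
    rw [h.1, h.2] at h1
    exact Prod.ext h.2 (h1.symm.trans h2)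
  · intro x hx
    obtain ⟨hv, hw, h⟩ := hS x hx
    have h1 := hAB _ hv _ hw
    rw [mem_product, mem_Ico, mem_Icc]
    refine ⟨⟨Nat.le_of_mul_le_mul_right (c := p) (by dsimp only; omega) hp,
      Nat.lt_of_mul_lt_mul_right (a := p) (by dsimp only; omega)⟩, (hA _ hv).2⟩
  · intro x hx
    obtain ⟨hv, hw, h⟩ := hS x hx
    simp only [h]
    rw [b_of_isSumTwoSquares (hA _ hv).1, b_of_isSumTwoSquares (hB _ hw)]
    simp
  · intros
    positivity

lemma sum_sum_b_mul_b_le_sum_G {M K : ℕ} {P : Finset ℕ} (hM : 1 ≤ M)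
    (hK : (K : ℝ) ≤ Real.log M ^ ((5 : ℝ) / 8)) (hP : P ⊆ Icc 1 K) :
    ∑ p ∈ P, ∑ n ∈ Ico M (2 * M), ∑ m ∈ Icc 1 (M * K), (b m * b (m + n * p) : ℝ) ≤
      ∑ n ∈ Ico M (2 * M), (G n : ℝ) := by
  rw [sum_comm]
  refine sum_le_sum fun n hn ↦ ?_
  have hMn : (M : ℝ) ≤ n := by exact_mod_cast (mem_Ico.1 hn).1
  have hM' : (1 : ℝ) ≤ M := by exact_mod_cast hM
  have hlog : (K : ℝ) ≤ Real.log n ^ ((5 : ℝ) / 8) :=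
    hK.trans (by have := Real.log_nonneg hM'; gcongr)
  unfold G
  push_cast
  refine (sum_le_sum fun p _ ↦ sum_le_sum_of_subset_of_nonneg (t := Icc 1
    ⌊(n : ℝ) * Real.log n ^ ((5 : ℝ) / 8)⌋₊) (Icc_subset_Icc_right (Nat.le_floor ?_))
    fun _ _ _ ↦ by positivity).trans (sum_le_sum_of_subset_of_nonneg
      (hP.trans (Icc_subset_Icc_right (Nat.le_floor hlog))) fun _ _ _ ↦ by positivity)
  push_cast
  gcongr

/-- A dilation `1 + s²` that places the sums of two squares in `(y, 1.1 y]` at distance between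
`N` and `2 N`. -/
lemma exists_sq_dilation {N y : ℕ} (hy : 0 < y) (h : 25 * y ≤ N) :
    ∃ s, 10 * N + y ≤ 10 * s ^ 2 * y ∧ 11 * (1 + s ^ 2) * y ≤ 20 * N + 10 * y := by
  have hex : ∃ s, 10 * N + y ≤ 10 * s ^ 2 * y := ⟨N + 1, by nlinarith⟩
  refine ⟨Nat.find hex, Nat.find_spec hex, ?_⟩
  obtain ⟨t, ht⟩ : ∃ t, Nat.find hex = t + 1 := Nat.exists_eq_succ_of_ne_zero fun h0 ↦ by
    have := Nat.find_spec hex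
    rw [h0] at this
    simp at this
    omega
  have hmin := Nat.find_min hex (m := t) (by omega)
  rw [ht]
  push Not at hmin
  rcases le_or_gt t 3 with h3 | h3
  · interval_cases t <;> omega
  · have : 22 * t * y + 14 * y ≤ 9 * t ^ 2 * y := by
      have : 22 * t + 14 ≤ 9 * t ^ 2 := by nlinarith
      calc _ = (22 * t + 14) * y := by ring
        _ ≤ _ := Nat.mul_le_mul_right _ this
    nlinarith

lemma le_sum_sum_b_mul_b {P A : Finset ℕ} {M N y W Q S : ℕ} (hP : ∀ p ∈ P, p.Prime)
    (hW : ∀ p ∈ P, p ∣ W) (hQ : 0 < Q) (hQP : ∀ p ∈ P, Q ≤ p) (hy : 0 < y)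
    (hA : ∀ n ∈ A, IsSumTwoSquares n ∧ y < n ∧ 10 * n ≤ 11 * y)
    (hPy : ∀ p ∈ P, 25 * y ≤ M * p) (hPS : ∀ p ∈ P, 20 * (M * p) + 10 * y ≤ 11 * S * y)
    (hPW : ∀ p ∈ P, 2 * (M * p) + y < W) (hyN : 11 * y ≤ 10 * N) :
    (#A : ℝ) ^ 2 * ∑ p ∈ P, 1 / (p : ℝ) - S * (#A * (W / Q : ℝ)) ≤
      ∑ p ∈ P, ∑ n ∈ Ico M (2 * M), ∑ m ∈ Icc 1 N, (b m * b (m + n * p) : ℝ) := by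
  have hs : ∀ p, ∃ s, p ∈ P → 10 * (M * p) + y ≤ 10 * s ^ 2 * y ∧
      11 * (1 + s ^ 2) * y ≤ 20 * (M * p) + 10 * y := by
    intro p
    by_cases hp : p ∈ P
    · obtain ⟨s, hs⟩ := exists_sq_dilation hy (hPy p hp)
      exact ⟨s, fun _ ↦ hs⟩
    · exact ⟨0, fun h ↦ absurd h hp⟩
  choose s hs using hs
  have hsS : ∀ p ∈ P, s p ∈ range S := by
    intro p hp
    have h1 := ((hs p hp).2.trans (hPS p hp))
    have h2 := Nat.le_of_mul_le_mul_right h1 hy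
    rw [mem_range]
    nlinarith
  rw [← sum_fiberwise_of_maps_to hsS, ← sum_fiberwise_of_maps_to hsS, mul_sum]
  have h : (S : ℝ) * (#A * (W / Q : ℝ)) = ∑ _i ∈ range S, #A * (W / Q : ℝ) := by simp
  rw [h, ← sum_sub_distrib]
  refine sum_le_sum fun i _ ↦ ?_
  rcases ({p ∈ P | s p = i} : Finset ℕ).eq_empty_or_nonempty with hE | ⟨p₀, hp₀⟩
  · rw [hE]
    simp only [sum_empty, mul_zero, zero_sub, Left.neg_nonpos_iff]
    positivity
  obtain ⟨hp₀, hi₀⟩ := mem_filter.1 hp₀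
  have hinj : Function.Injective fun u ↦ (1 + i ^ 2) * u :=
    fun u v huv ↦ Nat.eq_of_mul_eq_mul_left (by positivity) huv
  have hsub : ({p ∈ P | s p = i} : Finset ℕ) ⊆ P := filter_subset _ _
  have hupper : ∀ p ∈ P, s p = i → ∀ u ∈ A, 10 * ((1 + i ^ 2) * u) ≤ 20 * (M * p) + 10 * y := by
    rintro p hp rfl u hu
    have h1 := (hs p hp).2
    have h2 := Nat.mul_le_mul_left (1 + s p ^ 2) (hA u hu).2.2
    linarith
  refine (le_sum_card_filter_mod_eq (B := A.image fun u ↦ (1 + i ^ 2) * u)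
    (fun p hp ↦ hP p (hsub hp)) (fun p hp ↦ hW p (hsub hp)) hQ (fun p hp ↦ hQP p (hsub hp))
    ?_ ?_ (card_image_of_injective _ hinj).symm).trans (sum_le_sum fun p hp ↦ ?_)
  · intro v hv
    have h1 := hPy p₀ hp₀
    have h2 := hPW p₀ hp₀
    have h3 := (hA v hv).2.2
    rw [mem_range]
    omega
  · rw [image_subset_iff]
    intro u hu
    have h1 := hPW p₀ hp₀
    have h2 := hupper p₀ hp₀ hi₀ u hu
    rw [mem_range]
    omega
  · obtain ⟨hp, hi⟩ := mem_filter.1 hp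
    refine card_filter_mod_eq_le_sum (hP p hp).pos (fun v hv ↦ ?_) ?_ ?_
    · obtain ⟨h1, h2, h3⟩ := hA v hv
      exact ⟨h1, by omega, by omega⟩
    · rw [forall_mem_image]
      exact fun u hu ↦ IsSumTwoSquares.mul ⟨1, i, by push_cast; ring⟩ (hA u hu).1
    · intro v hv
      rw [forall_mem_image]
      intro u hu
      have h1 := hupper p hp hi u hu
      obtain ⟨-, h2, h3⟩ := hA v hv
      obtain ⟨-, h4, h5⟩ := hA u hu
      have h6 := (hs p hp).1
      rw [hi] at h6
      have h7 : i ^ 2 * y ≤ i ^ 2 * u := Nat.mul_le_mul_left _ h4.le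
      constructor
      · nlinarith
      · rw [mul_assoc 2 M p]
        omega

lemma inv_mul_le_sum_one_div {m C : ℕ} {l : ℝ} (hm : 1 ≤ m) (hC : 0 < C) (hl : 0 < l)
    (hCl : Real.log (C * m) ≤ l)
    (h : (m : ℝ) ≤ ∑ p ∈ primesOneModFour m (C * m), Real.log p) :
    1 / (C * l) ≤ ∑ p ∈ primesOneModFour m (C * m), 1 / (p : ℝ) := by
  have hm' : (0 : ℝ) < m := by exact_mod_cast hm
  have hC' : (0 : ℝ) < C := by exact_mod_cast hC
  calc 1 / (C * l) = m / (C * m * l) := by field_simp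
    _ ≤ (∑ p ∈ primesOneModFour m (C * m), Real.log p) / (C * m * l) := by gcongr
    _ = ∑ p ∈ primesOneModFour m (C * m), Real.log p / (C * m * l) := sum_div _ _ _
    _ ≤ _ := sum_le_sum fun p hp ↦ by
        have hp := mem_Ioc.1 (mem_filter.1 hp).1
        have hp0 : (0 : ℝ) < p := by exact_mod_cast (by omega : 0 < p)
        have hpC : (p : ℝ) ≤ C * m := by exact_mod_cast hp.2
        have hlog : Real.log p ≤ l := (Real.log_le_log hp0 hpC).trans hCl
        rw [div_le_div_iff₀ (by positivity) hp0, one_mul, mul_comm]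
        exact mul_le_mul hpC hlog (Real.log_natCast_nonneg p) (by positivity)

lemma four_pow_le_of_mul_two_le_log {K M : ℕ} (hM : 0 < M) (h : (K : ℝ) * 2 ≤ Real.log M) :
    4 ^ K ≤ M := by
  have hM' : (0 : ℝ) < M := by exact_mod_cast hM
  have h4 : Real.log 4 ≤ 2 := by
    rw [show (4 : ℝ) = 2 ^ 2 by norm_num, Real.log_pow]
    push_cast
    linarith [Real.log_two_lt_d9]
  have : ((4 ^ K : ℕ) : ℝ) ≤ M := by
    rw [← Real.log_le_log_iff (by positivity) hM']
    push_cast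
    rw [Real.log_pow]
    exact le_trans (by gcongr) h
  exact_mod_cast this

lemma exists_multiple_primorial {K M : ℕ} (hK : 1 ≤ K) (hM : 4 ^ K ≤ M) :
    ∃ W, (∀ p ≤ K, p.Prime → p ∣ W) ∧ 3 * (M * K) < W ∧ W ≤ 4 * (M * K) := by
  refine ⟨primorial K * (3 * (M * K) / primorial K + 1), fun p hpK hp ↦ ?_, ?_, ?_⟩
  · exact Dvd.dvd.mul_right (dvd_prod_of_mem _ (by simp [hp]; omega)) _
  · exact Nat.lt_mul_div_succ _ (primorial_pos K)
  · have h1 := Nat.mul_div_le (3 * (M * K)) (primorial K)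
    have h2 := primorial_le_four_pow K
    have h3 : M * 1 ≤ M * K := Nat.mul_le_mul_left _ hK
    rw [mul_add_one]
    omega

lemma sq_mul_sub_ge {c' C S M r l Z R T : ℝ} (hc : 0 < c') (hC : 0 < C) (hS : 0 < S) (hM : 0 < M)
    (hr : 0 < r) (hl : 0 < l) (hlr : l ≤ c' / (16 * S * C ^ 2) * r) (hZ : c' * M * r ≤ Z)
    (hR : 1 / (C * l) ≤ R) (hT : T ≤ 8 * C * M) :
    c' ^ 2 / (2 * C) * M ^ 2 * r ^ 2 / l ≤ Z ^ 2 * R - S * (Z * T) := by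
  have hZ0 : 0 < Z := lt_of_lt_of_le (by positivity) hZ
  have h1 : S * T ≤ Z / (2 * C * l) := by
    rw [le_div_iff₀ (by positivity)]
    have h2 : 16 * S * C ^ 2 * l ≤ c' * r := by
      calc _ ≤ 16 * S * C ^ 2 * (c' / (16 * S * C ^ 2) * r) := by gcongr
        _ = _ := by field_simp
    calc S * T * (2 * C * l) ≤ S * (8 * C * M) * (2 * C * l) := by gcongr
      _ = M * (16 * S * C ^ 2 * l) := by ring
      _ ≤ M * (c' * r) := by gcongr
      _ ≤ Z := by linarith
  calc c' ^ 2 / (2 * C) * M ^ 2 * r ^ 2 / l = (c' * M * r) ^ 2 / (2 * C * l) := by field_simp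
    _ ≤ Z ^ 2 / (2 * C * l) := by gcongr
    _ = Z ^ 2 * (1 / (C * l)) - Z * (Z / (2 * C * l)) := by field_simp; ring
    _ ≤ Z ^ 2 * R - Z * (S * T) := by gcongr
    _ = _ := by ring

lemma mul_rpow_le_div_sqrt_log {c L D M x : ℝ} (hc : 0 < c) (hD : 0 < D) (hL : 0 < L)
    (hM : 0 < M) (hx : 1 < x) (hxL : Real.log x ≤ 2 * L) (hDx : M * L ^ ((5 : ℝ) / 8) ≤ D * x) :
    c / (2 * D) * M * L ^ ((1 : ℝ) / 8) ≤ c * x / √(Real.log x) := by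
  have hlog : 0 < Real.log x := Real.log_pos hx
  have hsq : √(Real.log x) ≤ 2 * L ^ ((1 : ℝ) / 2) := by
    rw [← Real.sqrt_eq_rpow, show (2 : ℝ) = √4 by rw [show (4 : ℝ) = 2 ^ 2 by norm_num]; simp,
      ← Real.sqrt_mul (by norm_num)]
    exact Real.sqrt_le_sqrt (by linarith)
  have hL' : L ^ ((1 : ℝ) / 8) * L ^ ((1 : ℝ) / 2) = L ^ ((5 : ℝ) / 8) := by
    rw [← Real.rpow_add hL]
    norm_num
  rw [le_div_iff₀ (Real.sqrt_pos.2 hlog)]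
  calc c / (2 * D) * M * L ^ ((1 : ℝ) / 8) * √(Real.log x)
      ≤ c / (2 * D) * M * L ^ ((1 : ℝ) / 8) * (2 * L ^ ((1 : ℝ) / 2)) := by gcongr
    _ = c / D * (M * L ^ ((5 : ℝ) / 8)) := by rw [← hL']; field_simp
    _ ≤ c / D * (D * x) := by gcongr
    _ = c * x := by field_simp

/-- There is `c > 0` with `Σ_{M ≤ n < 2M} G(n) ≥ c·M²·(log M)^{1/4}/(log log M)`
for all sufficiently large `M`. -/
theorem sum_G_lower_bound :
    ∃ c : ℝ, 0 < c ∧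
      ∀ᶠ M : ℕ in atTop,
        c * M ^ 2 * Real.log M ^ ((1:ℝ)/4) / Real.log (Real.log M) ≤
          ∑ n ∈ Finset.Ico M (2 * M), (G n : ℝ) := by
  obtain ⟨C₀, m₀, hC₀, hm₀, hprimes⟩ := exists_le_sum_log_primesOneModFour
  obtain ⟨c, hc, C₁, hC₁, hshort⟩ := exists_le_card_isSumTwoSquares_short
  set S : ℕ := 1000 * C₀ * C₁ + 10 with hS
  set D : ℝ := 200 * C₀ * C₁ with hD
  have hC₀' : (0 : ℝ) < C₀ := by exact_mod_cast (by omega : 0 < C₀)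
  have hC₁' : (0 : ℝ) < C₁ := by exact_mod_cast (by omega : 0 < C₁)
  have hS' : (0 : ℝ) < S := by exact_mod_cast (by omega : 0 < S)
  have hD' : 0 < D := by positivity
  set c' := c / (2 * D) with hc'
  have hc'0 : 0 < c' := by positivity
  refine ⟨c' ^ 2 / (2 * C₀), by positivity, ?_⟩
  have hlog : Tendsto (fun M : ℕ ↦ Real.log M) atTop atTop :=
    Real.tendsto_log_atTop.comp tendsto_natCast_atTop_atTop
  have hrpow : Tendsto (fun M : ℕ ↦ Real.log M ^ ((5 : ℝ) / 8)) atTop atTop :=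
    (tendsto_rpow_atTop (by norm_num)).comp hlog
  have hdiv : Tendsto (fun M : ℕ ↦ M / (25 * C₁)) atTop atTop :=
    Nat.tendsto_div_const_atTop (by omega)
  have hsmall : ∀ᶠ L : ℝ in atTop, Real.log L ≤ c' / (16 * S * C₀ ^ 2) * L ^ ((1 : ℝ) / 8) := by
    filter_upwards [(isLittleO_log_rpow_atTop (by norm_num : (0 : ℝ) < 1 / 8)).def
      (by positivity : 0 < c' / (16 * S * C₀ ^ 2)), eventually_ge_atTop 1] with L hL hL1
    rwa [Real.norm_of_nonneg (Real.log_nonneg hL1), Real.norm_of_nonneg (by positivity)] at hL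
  have hhalf : ∀ᶠ L : ℝ in atTop, L ^ ((5 : ℝ) / 8) * 2 ≤ L := by
    filter_upwards [(tendsto_rpow_atTop (by norm_num : (0 : ℝ) < 3 / 8)).eventually_ge_atTop 2,
      eventually_gt_atTop 0] with L hL hL0
    calc L ^ ((5 : ℝ) / 8) * 2 ≤ L ^ ((5 : ℝ) / 8) * L ^ ((3 : ℝ) / 8) := by gcongr
      _ = L := by rw [← Real.rpow_add hL0]; norm_num
  filter_upwards [hlog.eventually hsmall, hlog.eventually hhalf, hlog.eventually_gt_atTop 1,
    hrpow.eventually_ge_atTop (C₀ * m₀ : ℕ),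
    hdiv.eventually (eventually_forall_ge_atTop.2 hshort), eventually_ge_atTop (50 * C₁)]
    with M hM1 hM2 hM3 hM4 hM5 hM6
  set L := Real.log M with hL
  have hL0 : 0 < L := by linarith
  have hM0 : 0 < M := by omega
  have hM0' : (0 : ℝ) < M := by exact_mod_cast hM0
  obtain ⟨K, hK⟩ : ∃ K, K = ⌊L ^ ((5 : ℝ) / 8)⌋₊ := ⟨_, rfl⟩
  have hKL : (K : ℝ) ≤ L ^ ((5 : ℝ) / 8) := hK ▸ Nat.floor_le (by positivity)
  have hLK : L ^ ((5 : ℝ) / 8) < K + 1 := hK ▸ Nat.lt_floor_add_one _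
  have hKm : C₀ * m₀ ≤ K := hK ▸ Nat.le_floor hM4
  obtain ⟨K₁, hK₁⟩ : ∃ K₁, K₁ = K / C₀ := ⟨_, rfl⟩
  have hmK₁ : m₀ ≤ K₁ := by
    rw [hK₁, Nat.le_div_iff_mul_le (by omega)]
    linarith
  have hCK : C₀ * K₁ ≤ K := hK₁ ▸ Nat.mul_div_le K C₀
  have hKC : K ≤ 2 * C₀ * K₁ := by
    have h1 : K < C₀ * (K₁ + 1) := hK₁ ▸ Nat.lt_mul_div_succ K (by omega)
    have h2 : C₀ * 1 ≤ C₀ * K₁ := Nat.mul_le_mul_left _ (by omega)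
    linarith
  have hKM : 4 ^ K ≤ M := four_pow_le_of_mul_two_le_log hM0 (by linarith)
  have hK₁K : K₁ ≤ K := hK₁ ▸ Nat.div_le_self K C₀
  have hK₁M : K₁ ≤ M := hK₁K.trans ((Nat.lt_pow_self (by norm_num)).le.trans hKM)
  obtain ⟨W, hWP, hWK, hKW⟩ := exists_multiple_primorial (by omega : 1 ≤ K) hKM
  obtain ⟨x, hx⟩ : ∃ x, x = M * K₁ / (25 * C₁) := ⟨_, rfl⟩
  have hMK₁ : M * 1 ≤ M * K₁ := Nat.mul_le_mul_left _ (by omega)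
  have hxM : M / (25 * C₁) ≤ x := hx ▸ Nat.div_le_div_right (by omega)
  have hx2 : 2 ≤ x := by
    refine le_trans ?_ hxM
    rw [Nat.le_div_iff_mul_le (by omega)]
    omega
  have hxK : 25 * C₁ * x ≤ M * K₁ := hx ▸ Nat.mul_div_le _ _
  have hKx : M * K₁ ≤ 50 * C₁ * x := by
    have h1 : M * K₁ < 25 * C₁ * (x + 1) := hx ▸ Nat.lt_mul_div_succ _ (by omega)
    nlinarith
  obtain ⟨y, A, hxy, hyx, hA, hcard⟩ := hM5 x hxM
  have hyK : 25 * y ≤ M * K₁ := by linarith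
  have hKy : M * K₁ ≤ 50 * C₁ * y := hKx.trans (Nat.mul_le_mul_left _ hxy)
  have hMKK : M * K₁ ≤ M * K := Nat.mul_le_mul_left _ hK₁K
  have hP : ∀ p ∈ primesOneModFour K₁ (C₀ * K₁), K₁ ≤ p ∧ p ≤ C₀ * K₁ ∧ p.Prime := by
    intro p hp
    obtain ⟨hp, hp', -⟩ := mem_filter.1 hp
    exact ⟨(mem_Ioc.1 hp).1.le, (mem_Ioc.1 hp).2, hp'⟩
  have hMP : ∀ p ∈ primesOneModFour K₁ (C₀ * K₁), M * K₁ ≤ M * p ∧ M * p ≤ C₀ * (M * K₁) ∧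
      M * p ≤ M * K := by
    intro p hp
    obtain ⟨h1, h2, -⟩ := hP p hp
    refine ⟨Nat.mul_le_mul_left _ h1, ?_, Nat.mul_le_mul_left _ (h2.trans hCK)⟩
    calc M * p ≤ M * (C₀ * K₁) := Nat.mul_le_mul_left _ h2
      _ = _ := by ring
  refine le_trans ?_ ((le_sum_sum_b_mul_b (P := primesOneModFour K₁ (C₀ * K₁)) (A := A) (M := M)
    (N := M * K) (y := y) (W := W) (Q := K₁) (S := S) (fun p hp ↦ (hP p hp).2.2)
    (fun p hp ↦ hWP p ((hP p hp).2.1.trans hCK) (hP p hp).2.2) (by omega)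
    (fun p hp ↦ (hP p hp).1) (by omega) hA (fun p hp ↦ hyK.trans (hMP p hp).1) ?_ ?_ ?_).trans
    (sum_sum_b_mul_b_le_sum_G hM0 hKL ?_))
  · have hlogx : Real.log x ≤ 2 * L := by
      have h1 : (x : ℝ) ≤ M ^ 2 := by
        have h2 : x ≤ M * K₁ := hx ▸ Nat.div_le_self _ _
        have h3 : M * K₁ ≤ M * M := Nat.mul_le_mul_left _ hK₁M
        rw [sq]
        exact_mod_cast h2.trans h3
      calc Real.log x ≤ Real.log (M ^ 2) := Real.log_le_log (by positivity) h1
        _ = 2 * L := by rw [Real.log_pow]; rfl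
    have hDx : M * L ^ ((5 : ℝ) / 8) ≤ D * x := by
      have h1 : (1 : ℝ) ≤ K := by exact_mod_cast (by omega : 1 ≤ K)
      have h2 : (K : ℝ) ≤ 2 * C₀ * K₁ := by exact_mod_cast hKC
      have h3 : (M : ℝ) * K₁ ≤ 50 * C₁ * x := by exact_mod_cast hKx
      calc M * L ^ ((5 : ℝ) / 8) ≤ M * (2 * (2 * C₀ * K₁)) := by
            gcongr
            linarith
        _ = 4 * C₀ * (M * K₁) := by ring
        _ ≤ 4 * C₀ * (50 * C₁ * x) := by gcongr
        _ = D * x := by rw [hD]; ring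
    have hZ : c' * M * L ^ ((1 : ℝ) / 8) ≤ #A :=
      (mul_rpow_le_div_sqrt_log hc hD' hL0 hM0' (by exact_mod_cast hx2) hlogx hDx).trans hcard
    have hlogL : 0 < Real.log L := Real.log_pos hM3
    have hR := inv_mul_le_sum_one_div (m := K₁) (C := C₀) (l := Real.log L) (by omega) (by omega)
      hlogL (by
        have h1 : (C₀ * K₁ : ℝ) ≤ L := by
          have h2 : (C₀ * K₁ : ℝ) ≤ K := by exact_mod_cast hCK
          have h3 : (0 : ℝ) ≤ K := by positivity
          linarith
        have h2 : (0 : ℝ) < K₁ := by exact_mod_cast (by omega : 0 < K₁)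
        exact Real.log_le_log (by positivity) h1) (hprimes K₁ hmK₁)
    have hT : (W / K₁ : ℝ) ≤ 8 * C₀ * M := by
      have h2 : (0 : ℝ) < K₁ := by exact_mod_cast (by omega : 0 < K₁)
      rw [div_le_iff₀ h2]
      have h3 : W ≤ 8 * C₀ * M * K₁ := by
        have := Nat.mul_le_mul_left (4 * M) hKC
        linarith
      exact_mod_cast h3
    have hr : L ^ ((1 : ℝ) / 4) = (L ^ ((1 : ℝ) / 8)) ^ 2 := by
      rw [← Real.rpow_natCast, ← Real.rpow_mul hL0.le]
      norm_num
    rw [hr]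
    exact sq_mul_sub_ge hc'0 hC₀' hS' hM0' (by positivity) hlogL hM1 hZ hR hT
  · intro p hp
    have h1 := (hMP p hp).2.1
    have h2 : C₀ * (M * K₁) ≤ C₀ * (50 * C₁ * y) := Nat.mul_le_mul_left _ hKy
    rw [hS]
    nlinarith
  · intro p hp
    have := (hMP p hp).2.2
    omega
  · omega
  · intro p hp
    obtain ⟨-, h1, h2⟩ := hP p hp
    exact mem_Icc.2 ⟨h2.one_le, h1.trans hCK⟩
end

section
/- There exists a constant C > 0 such that for all sufficiently large n one has G(n) ≤ C·n·(log n)^{1/4}·(log log n). -/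
open Real Filter Finset
open scoped Classical

theorem sum_range_le_of_periodic {F : ℕ → ℝ} {q : ℕ} (hq : 0 < q) (hF : Function.Periodic F q)
    (hF1 : ∀ m, |F m| ≤ 1) (hs : 0 ≤ ∑ m ∈ range q, F m) (N : ℕ) :
    ∑ m ∈ range N, F m ≤ N / q * ∑ m ∈ range q, F m + q := by
  have hfull (k : ℕ) : ∑ m ∈ range (q * k), F m = k * ∑ m ∈ range q, F m := by
    induction k with
    | zero => simp
    | succ k ih =>
      rw [mul_add_one, sum_range_add, ih]
      have (x : ℕ) : F (q * k + x) = F x := by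
        have := hF.nat_mul k x
        rwa [Nat.cast_id, show x + k * q = q * k + x by ring] at this
      simp only [this]
      push_cast
      ring
  have hrem : ∑ x ∈ range (N % q), F (q * (N / q) + x) ≤ q := by
    calc ∑ x ∈ range (N % q), F (q * (N / q) + x) ≤ ∑ x ∈ range (N % q), (1 : ℝ) :=
          sum_le_sum fun x _ => (le_abs_self _).trans (hF1 _)
      _ = ((N % q : ℕ) : ℝ) := by simp
      _ ≤ q := by exact_mod_cast (Nat.mod_lt _ hq).le
  have hle : ((N / q : ℕ) : ℝ) * ∑ m ∈ range q, F m ≤ N / q * ∑ m ∈ range q, F m :=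
    mul_le_mul_of_nonneg_right Nat.cast_div_le hs
  calc ∑ m ∈ range N, F m = ∑ m ∈ range (q * (N / q) + N % q), F m := by rw [Nat.div_add_mod]
    _ = ((N / q : ℕ) : ℝ) * ∑ m ∈ range q, F m + ∑ x ∈ range (N % q), F (q * (N / q) + x) := by
      rw [sum_range_add, hfull]
    _ ≤ _ := by linarith

theorem sum_range_mul_of_coprime {u v : ℕ} (hu : 0 < u) (hv : 0 < v) (huv : u.Coprime v)
    {f g : ℕ → ℝ} (hf : Function.Periodic f u) (hg : Function.Periodic g v) :
    ∑ m ∈ range (u * v), f m * g m = (∑ m ∈ range u, f m) * ∑ m ∈ range v, g m := by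
  rw [sum_mul_sum, ← sum_product']
  have hinj : Set.InjOn (fun m => (m % u, m % v)) (range (u * v) : Set ℕ) := by
    intro m hm n hn hmn
    simp only [coe_range, Set.mem_Iio, Prod.mk.injEq] at hm hn hmn
    exact Nat.ModEq.eq_of_lt_of_lt ((Nat.modEq_and_modEq_iff_modEq_mul huv).1 hmn) hm hn
  have hmap : ∀ m ∈ range (u * v), (m % u, m % v) ∈ range u ×ˢ range v := fun m _ => by
    simp [Nat.mod_lt _ hu, Nat.mod_lt _ hv]
  refine sum_nbij (fun m => (m % u, m % v)) hmap hinj ?_ ?_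
  · exact surjOn_of_injOn_of_card_le _ hmap hinj (by simp)
  · intro m _
    rw [hf.map_mod_nat, hg.map_mod_nat]

theorem periodic_prod {s : Finset ℕ} {q : ℕ → ℕ} {F : ℕ → ℕ → ℝ}
    (hF : ∀ p ∈ s, Function.Periodic (F p) (q p)) :
    Function.Periodic (fun m => ∏ p ∈ s, F p m) (∏ p ∈ s, q p) := by
  intro m
  refine prod_congr rfl fun p hp => ?_
  obtain ⟨c, hc⟩ := dvd_prod_of_mem q hp
  have := (hF p hp).nat_mul c m
  rw [hc, mul_comm]
  exact_mod_cast this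

theorem sum_range_prod_of_coprime {s : Finset ℕ} {q : ℕ → ℕ} (hq : ∀ p ∈ s, 0 < q p)
    (hco : ∀ p ∈ s, ∀ r ∈ s, p ≠ r → (q p).Coprime (q r)) {F : ℕ → ℕ → ℝ}
    (hF : ∀ p ∈ s, Function.Periodic (F p) (q p)) :
    ∑ m ∈ range (∏ p ∈ s, q p), ∏ p ∈ s, F p m = ∏ p ∈ s, ∑ m ∈ range (q p), F p m := by
  induction s using Finset.induction_on with
  | empty => simp
  | insert a s ha ih =>
    simp only [mem_insert, forall_eq_or_imp] at hq hF
    simp only [prod_insert ha]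
    rw [sum_range_mul_of_coprime hq.1 (prod_pos hq.2) _ hF.1 (periodic_prod hF.2),
      ih hq.2 (fun p hp r hr => hco p (mem_insert_of_mem hp) r (mem_insert_of_mem hr)) hF.2]
    exact Nat.Coprime.prod_right fun r hr => hco a (mem_insert_self _ _) r (mem_insert_of_mem hr)
      (fun h => ha (h ▸ hr))

/-- An upper-bound sieve that removes, for each prime `p ∈ P`, the `ρ p` residue classes
modulo `p ^ 2` on which `β p` equals `1`. -/
theorem card_sq_sieve_le {P : Finset ℕ} (hP : ∀ p ∈ P, p.Prime) {β : ℕ → ℕ → ℝ} {ρ : ℕ → ℝ}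
    (hβ : ∀ p ∈ P, ∀ m, β p m = 0 ∨ β p m = 1)
    (hper : ∀ p ∈ P, Function.Periodic (β p) (p ^ 2))
    (hsum : ∀ p ∈ P, ∑ m ∈ range (p ^ 2), β p m = ρ p)
    (hρ : ∀ p ∈ P, 0 < ρ p) (hρ2 : ∀ p ∈ P, 2 * ρ p ≤ (p : ℝ) ^ 2)
    {D : ℕ} {𝒜 : Finset (Finset ℕ)} (h𝒜 : ∀ A ∈ 𝒜, A ⊆ P) (hD : ∀ A ∈ 𝒜, ∏ p ∈ A, p ≤ D)
    {N : ℕ} {T : Finset ℕ} (hT : T ⊆ range N) (hTβ : ∀ m ∈ T, ∀ p ∈ P, β p m = 0) :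
    (#T : ℝ) * (∑ A ∈ 𝒜, ∏ p ∈ A, ρ p / ((p : ℝ) ^ 2 - ρ p)) ^ 2 ≤
      N * (∑ A ∈ 𝒜, ∏ p ∈ A, ρ p / ((p : ℝ) ^ 2 - ρ p)) + (D : ℝ) ^ 4 * (#𝒜 : ℝ) ^ 2 := by
  set h : ℕ → ℝ := fun p => ρ p / ((p : ℝ) ^ 2 - ρ p) with hh
  have hden : ∀ p ∈ P, 0 < (p : ℝ) ^ 2 - ρ p := fun p hp => by
    have := hρ p hp
    have := hρ2 p hp
    linarith
  have hh1 : ∀ p ∈ P, h p ≤ 1 := fun p hp => by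
    rw [hh]
    simp only
    rw [div_le_one (hden p hp)]
    linarith [hρ2 p hp]
  have hh0 : ∀ p ∈ P, 0 < h p := fun p hp => div_pos (hρ p hp) (hden p hp)
  set φ : ℕ → ℕ → ℝ := fun p m => h p * (1 - β p m * ((p : ℝ) ^ 2 / ρ p)) with hφ
  have hφ_val : ∀ p ∈ P, ∀ m, φ p m = h p - β p m * (1 + h p) := fun p hp m => by
    have := (hρ p hp).ne'
    have := (hden p hp).ne'
    simp only [hφ, hh]
    field_simp
    ring
  have hφ_abs : ∀ p ∈ P, ∀ m, |φ p m| ≤ 1 := fun p hp m => by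
    have h0 := hh0 p hp
    have h1 := hh1 p hp
    rw [hφ_val p hp, abs_le]
    rcases hβ p hp m with h | h <;> rw [h] <;> constructor <;> linarith
  have hφ_per : ∀ p ∈ P, Function.Periodic (φ p) (p ^ 2) := fun p hp m => by
    simp only [hφ, hper p hp m]
  have hφ_sum : ∀ p ∈ P, ∑ m ∈ range (p ^ 2), φ p m = 0 := fun p hp => by
    have := (hρ p hp).ne'
    simp only [hφ]
    rw [← mul_sum, sum_sub_distrib, ← sum_mul, hsum p hp]
    simp
    right
    field_simp
    ring
  have hφ_sq : ∀ p ∈ P, ∑ m ∈ range (p ^ 2), φ p m * φ p m = h p * (p : ℝ) ^ 2 := fun p hp => by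
    have e (m : ℕ) : φ p m * φ p m = h p * φ p m + (1 + h p) * β p m := by
      rw [hφ_val p hp]
      rcases hβ p hp m with h | h <;> rw [h] <;> ring
    simp only [e]
    rw [sum_add_distrib, ← mul_sum _ (φ p), ← mul_sum _ (β p), hφ_sum p hp, hsum p hp]
    have := (hden p hp).ne'
    simp only [hh]
    field_simp
    ring
  have key : ∀ A ∈ 𝒜, ∀ B ∈ 𝒜, ∑ m ∈ range N, (∏ p ∈ A, φ p m) * ∏ p ∈ B, φ p m ≤
      (if A = B then N * ∏ p ∈ A, h p else 0) + (D : ℝ) ^ 4 := by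
    intro A hA B hB
    have hU : A ∪ B ⊆ P := union_subset (h𝒜 A hA) (h𝒜 B hB)
    set F : ℕ → ℕ → ℝ := fun p m => (if p ∈ A then φ p m else 1) * (if p ∈ B then φ p m else 1)
      with hF
    have hFprod (m : ℕ) : (∏ p ∈ A, φ p m) * ∏ p ∈ B, φ p m = ∏ p ∈ A ∪ B, F p m := by
      simp only [hF, prod_mul_distrib, prod_ite_mem]
      congr 2 <;> simp
    have hFper : ∀ p ∈ A ∪ B, Function.Periodic (F p) (p ^ 2) := fun p hp m => by
      simp only [hF, hφ_per p (hU hp) m]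
    have hFabs : ∀ p ∈ A ∪ B, ∀ m, |F p m| ≤ 1 := fun p hp m => by
      have := hφ_abs p (hU hp) m
      simp only [hF, abs_mul]
      refine mul_le_one₀ ?_ (abs_nonneg _) ?_ <;> split_ifs <;> simp [this]
    have hqpos : 0 < ∏ p ∈ A ∪ B, p ^ 2 := prod_pos fun p hp => pow_pos (hP p (hU hp)).pos 2
    have hqle : ∏ p ∈ A ∪ B, p ^ 2 ≤ D ^ 4 := by
      rw [prod_pow]
      have : ∏ p ∈ A ∪ B, p ≤ D * D := by
        calc ∏ p ∈ A ∪ B, p ≤ (∏ p ∈ A ∪ B, p) * ∏ p ∈ A ∩ B, p :=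
              Nat.le_mul_of_pos_right _
                (prod_pos fun p hp => (hP p (h𝒜 A hA (mem_inter.1 hp).1)).pos)
          _ = (∏ p ∈ A, p) * ∏ p ∈ B, p := prod_union_inter
          _ ≤ D * D := Nat.mul_le_mul (hD A hA) (hD B hB)
      calc _ ≤ (D * D) ^ 2 := Nat.pow_le_pow_left this 2
        _ = D ^ 4 := by ring
    have hmean : ∑ m ∈ range (∏ p ∈ A ∪ B, p ^ 2), ∏ p ∈ A ∪ B, F p m =
        if A = B then (∏ p ∈ A, h p) * ((∏ p ∈ A ∪ B, p ^ 2 : ℕ) : ℝ) else 0 := by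
      rw [sum_range_prod_of_coprime (fun p hp => pow_pos (hP p (hU hp)).pos 2) _ hFper]
      · split_ifs with hAB
        · subst hAB
          simp only [union_self]
          push_cast
          rw [← prod_mul_distrib]
          refine prod_congr rfl fun p hp => ?_
          simp only [hF, hp, if_true]
          exact hφ_sq p (h𝒜 A hA hp)
        · obtain ⟨p, hp⟩ : ∃ p, ¬(p ∈ A ↔ p ∈ B) := by
            by_contra! hc
            exact hAB (Finset.ext hc)
          by_cases hpA : p ∈ A
          · have hpB : p ∉ B := fun hb => hp ⟨fun _ => hb, fun _ => hpA⟩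
            refine prod_eq_zero (mem_union_left _ hpA) ?_
            simpa [hF, hpA, hpB] using hφ_sum p (h𝒜 A hA hpA)
          · have hpB : p ∈ B := by
              by_contra hb
              exact hp ⟨fun h => absurd h hpA, fun h => absurd h hb⟩
            refine prod_eq_zero (mem_union_right _ hpB) ?_
            simpa [hF, hpA, hpB] using hφ_sum p (h𝒜 B hB hpB)
      · intro p hp r hr hpr
        exact Nat.Coprime.pow 2 2 ((Nat.coprime_primes (hP p (hU hp)) (hP r (hU hr))).2 hpr)
    have hAnn : 0 ≤ ∏ p ∈ A, h p := prod_nonneg fun p hp => (hh0 p (h𝒜 A hA hp)).le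
    simp only [hFprod]
    refine (sum_range_le_of_periodic hqpos (periodic_prod hFper) (fun m => ?_) ?_ N).trans ?_
    · rw [abs_prod]
      exact prod_le_one (fun _ _ => abs_nonneg _) fun p hp => hFabs p hp m
    · rw [hmean]
      split_ifs
      · positivity
      · exact le_rfl
    · rw [hmean]
      have hq0 : ((∏ p ∈ A ∪ B, p ^ 2 : ℕ) : ℝ) ≠ 0 := by exact_mod_cast hqpos.ne'
      have hq4 : ((∏ p ∈ A ∪ B, p ^ 2 : ℕ) : ℝ) ≤ (D : ℝ) ^ 4 := by exact_mod_cast hqle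
      split_ifs
      · refine add_le_add (le_of_eq ?_) hq4
        field_simp
      · simpa using hq4
  calc (#T : ℝ) * (∑ A ∈ 𝒜, ∏ p ∈ A, h p) ^ 2
      = ∑ m ∈ T, (∑ A ∈ 𝒜, ∏ p ∈ A, φ p m) ^ 2 := by
        rw [← nsmul_eq_mul, ← sum_const]
        refine sum_congr rfl fun m hm => ?_
        congr 1
        refine sum_congr rfl fun A hA => prod_congr rfl fun p hp => ?_
        simp [hφ, hTβ m hm p (h𝒜 A hA hp)]
    _ ≤ ∑ m ∈ range N, (∑ A ∈ 𝒜, ∏ p ∈ A, φ p m) ^ 2 :=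
        sum_le_sum_of_subset_of_nonneg hT fun _ _ _ => sq_nonneg _
    _ = ∑ A ∈ 𝒜, ∑ B ∈ 𝒜, ∑ m ∈ range N, (∏ p ∈ A, φ p m) * ∏ p ∈ B, φ p m := by
        simp only [sq, sum_mul_sum]
        rw [sum_comm]
        exact sum_congr rfl fun A _ => sum_comm
    _ ≤ ∑ A ∈ 𝒜, ∑ B ∈ 𝒜, ((if A = B then N * ∏ p ∈ A, h p else 0) + (D : ℝ) ^ 4) :=
        sum_le_sum fun A hA => sum_le_sum fun B hB => key A hA B hB
    _ = N * (∑ A ∈ 𝒜, ∏ p ∈ A, h p) + (D : ℝ) ^ 4 * (#𝒜 : ℝ) ^ 2 := by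
        simp only [sum_add_distrib, sum_ite_eq, sum_const, nsmul_eq_mul, mul_sum]
        rw [sum_ite_mem, inter_self]
        ring

/-- The multiplicative function supported on integers all of whose prime factors are `3` modulo `4`,
with value `2 ^ ω n` there. -/
noncomputable def twoPowOmegaThree : ArithmeticFunction ℝ :=
  ArithmeticFunction.prodPrimeFactors fun p => if p % 4 = 3 then 2 else 0

/-- The nontrivial character modulo `4`, as a real arithmetic function. -/
noncomputable def chiFour : ArithmeticFunction ℝ :=
  ⟨fun n => ((ZMod.χ₄ n : ℤ) : ℝ), by simp⟩

theorem chiFour_apply (n : ℕ) : chiFour n = ((ZMod.χ₄ n : ℤ) : ℝ) := rfl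

theorem chiFour_mul (m n : ℕ) : chiFour (m * n) = chiFour m * chiFour n := by
  simp only [chiFour_apply, Nat.cast_mul, map_mul, Int.cast_mul]

theorem chiFour_isMultiplicative : chiFour.IsMultiplicative :=
  ⟨by simp [chiFour_apply], fun {m n} _ => chiFour_mul m n⟩

theorem chiFour_eq_ite (n : ℕ) :
    chiFour n = if n % 2 = 0 then 0 else if n % 4 = 1 then 1 else -1 := by
  rw [chiFour_apply, ZMod.χ₄_nat_eq_if_mod_four]
  split_ifs <;> simp

theorem chiFour_pow (m k : ℕ) : chiFour (m ^ k) = chiFour m ^ k := by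
  simp only [chiFour_apply, Nat.cast_pow, map_pow, Int.cast_pow]

theorem twoPowOmegaThree_mul_chiFour :
    twoPowOmegaThree * chiFour = ArithmeticFunction.pmul chiFour chiFour := by
  have hF : twoPowOmegaThree.IsMultiplicative :=
    ArithmeticFunction.IsMultiplicative.prodPrimeFactors _
  refine (ArithmeticFunction.IsMultiplicative.eq_iff_eq_on_prime_powers _
    (hF.mul chiFour_isMultiplicative) _
    (chiFour_isMultiplicative.pmul chiFour_isMultiplicative)).2 fun p k hp => ?_
  rw [ArithmeticFunction.mul_apply,
    Nat.sum_divisorsAntidiagonal (fun x y => twoPowOmegaThree x * chiFour y),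
    Nat.sum_divisors_prime_pow hp, ArithmeticFunction.pmul_apply, chiFour_pow]
  set c := chiFour p with hc
  have hval : ∀ i, twoPowOmegaThree (p ^ (i + 1)) = c ^ 2 - c := fun i => by
    rw [twoPowOmegaThree, ArithmeticFunction.prodPrimeFactors_apply (pow_ne_zero _ hp.ne_zero),
      Nat.primeFactors_prime_pow (Nat.succ_ne_zero i) hp, prod_singleton, hc, chiFour_eq_ite]
    split_ifs <;> first | omega | norm_num
  have hc3 : c ^ 2 * c ^ 2 = c ^ 2 ∧ c ^ 3 = c := by
    rw [hc, chiFour_eq_ite]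
    split_ifs <;> norm_num
  induction k with
  | zero => simp [hF.map_one, chiFour_isMultiplicative.map_one]
  | succ k ih =>
    rw [sum_range_succ, Nat.div_self (pow_pos hp.pos _), chiFour_isMultiplicative.map_one, hval]
    have : ∑ x ∈ range (k + 1), twoPowOmegaThree (p ^ x) * chiFour (p ^ (k + 1) / p ^ x) =
        c * ∑ x ∈ range (k + 1), twoPowOmegaThree (p ^ x) * chiFour (p ^ k / p ^ x) := by
      rw [mul_sum]
      refine sum_congr rfl fun x hx => ?_
      have hx : x ≤ k := by simpa [Nat.lt_succ_iff] using hx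
      rw [Nat.pow_div (hx.trans k.le_succ) hp.pos, Nat.pow_div hx hp.pos,
        show k + 1 - x = (k - x) + 1 by omega, chiFour_pow, chiFour_pow]
      ring
    rw [this, ih]
    have h2 : ∀ j, c * (c ^ j * c ^ j) = c := fun j => by
      induction j with
      | zero => simp
      | succ j ihj =>
        calc c * (c ^ (j + 1) * c ^ (j + 1)) = c * (c ^ j * c ^ j) * c ^ 2 := by ring
          _ = c ^ 3 := by rw [ihj]; ring
          _ = c := hc3.2
    have h3 : c ^ (k + 1) * c ^ (k + 1) = c ^ 2 := by
      calc c ^ (k + 1) * c ^ (k + 1) = c * (c ^ k * c ^ k) * c := by ring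
        _ = c ^ 2 := by rw [h2]; ring
    rw [h2, h3]
    ring

theorem sum_chiFour_div_le_one (n : ℕ) : ∑ e ∈ Ioc 0 n, chiFour e / e ≤ 1 := by
  have key (n : ℕ) : ∑ e ∈ Ioc 0 n, chiFour e / e ≤
      if n % 4 = 1 ∨ n % 4 = 2 then 1 else 1 - 1 / ((n + 1 : ℕ) : ℝ) := by
    induction n with
    | zero => simp
    | succ n ih =>
      rw [sum_Ioc_succ_top (Nat.zero_le _), chiFour_eq_ite (n + 1)]
      have hle : 1 / ((n + 1 + 1 : ℕ) : ℝ) ≤ 1 / ((n + 1 : ℕ) : ℝ) := by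
        gcongr
        omega
      have h4 : n % 4 < 4 := Nat.mod_lt _ (by norm_num)
      obtain h | h | h | h : n % 4 = 0 ∨ n % 4 = 1 ∨ n % 4 = 2 ∨ n % 4 = 3 := by omega
      · rw [if_neg (by omega)] at ih
        rw [if_neg (by omega), if_pos (by omega), if_pos (by omega)]
        linarith
      · rw [if_pos (by omega)] at ih
        rw [if_pos (by omega), if_pos (by omega), zero_div]
        linarith
      · rw [if_pos (by omega)] at ih
        rw [if_neg (by omega), if_neg (by omega), if_neg (by omega), neg_div]
        linarith
      · rw [if_neg (by omega)] at ih
        rw [if_pos (by omega), if_neg (by omega), zero_div]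
        linarith
  refine (key n).trans ?_
  split_ifs
  · exact le_rfl
  · have : (0 : ℝ) ≤ 1 / ((n + 1 : ℕ) : ℝ) := by positivity
    linarith

theorem half_log_le_sum_chiFour_sq (n : ℕ) :
    Real.log n / 2 ≤ ∑ m ∈ Ioc 0 n, chiFour m * chiFour m / m := by
  have halt (n : ℕ) : (if n % 2 = 1 then 1 / (n : ℝ) else 0) ≤
      ∑ m ∈ Ioc 0 n, (2 * (chiFour m * chiFour m / m) - 1 / m) := by
    induction n with
    | zero => simp
    | succ n ih =>
      rw [sum_Ioc_succ_top (Nat.zero_le _), chiFour_eq_ite (n + 1)]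
      rcases Nat.mod_two_eq_zero_or_one n with h | h
      · rw [if_neg (by omega)] at ih
        rw [if_pos (by omega), if_neg (by omega)]
        have : ((if (n + 1) % 4 = 1 then (1 : ℝ) else -1) *
          (if (n + 1) % 4 = 1 then (1 : ℝ) else -1)) = 1 := by split_ifs <;> norm_num
        rw [this]
        linarith
      · rw [if_pos h] at ih
        rw [if_neg (by omega), if_pos (by omega)]
        have hn : 0 < n := by omega
        have : 1 / ((n + 1 : ℕ) : ℝ) ≤ 1 / n := by
          gcongr
          omega
        simp only [mul_zero, zero_div]
        linarith
  have h0 : 0 ≤ ∑ m ∈ Ioc 0 n, (2 * (chiFour m * chiFour m / m) - 1 / m) := by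
    refine le_trans ?_ (halt n)
    split_ifs <;> positivity
  rw [sum_sub_distrib, ← mul_sum] at h0
  have hlog : Real.log n ≤ ∑ m ∈ Ioc 0 n, 1 / (m : ℝ) := by
    rcases Nat.eq_zero_or_pos n with rfl | hn
    · simp
    · have := log_add_one_le_harmonic n
      rw [harmonic_eq_sum_Icc] at this
      push_cast at this
      refine le_trans (Real.log_le_log (by exact_mod_cast hn) (by linarith)) (this.trans (le_of_eq ?_))
      exact sum_congr (by ext; simp [Nat.succ_le_iff]) fun _ _ => by simp
  linarith

theorem twoPowOmegaThree_nonneg (n : ℕ) : 0 ≤ twoPowOmegaThree n := by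
  rcases eq_or_ne n 0 with rfl | hn
  · simp
  · rw [twoPowOmegaThree, ArithmeticFunction.prodPrimeFactors_apply hn]
    exact prod_nonneg fun p _ => by split_ifs <;> norm_num

theorem half_log_le_sum_twoPowOmegaThree (n : ℕ) :
    Real.log n / 2 ≤ ∑ d ∈ Ioc 0 n, twoPowOmegaThree d / d := by
  set W : ArithmeticFunction ℝ := ⟨fun n => (n : ℝ)⁻¹, by simp⟩ with hW
  have hWa (n : ℕ) : W n = (n : ℝ)⁻¹ := rfl
  have hconv : ArithmeticFunction.pmul twoPowOmegaThree W * ArithmeticFunction.pmul chiFour W =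
      ArithmeticFunction.pmul (ArithmeticFunction.pmul chiFour chiFour) W := by
    rw [← twoPowOmegaThree_mul_chiFour]
    ext m
    simp only [ArithmeticFunction.mul_apply, ArithmeticFunction.pmul_apply, hWa, sum_mul]
    refine sum_congr rfl fun x hx => ?_
    rw [← (Nat.mem_divisorsAntidiagonal.1 hx).1]
    push_cast
    rw [mul_inv]
    ring
  have hsum := ArithmeticFunction.sum_Ioc_mul_eq_sum_sum
    (ArithmeticFunction.pmul twoPowOmegaThree W) (ArithmeticFunction.pmul chiFour W) n
  rw [hconv] at hsum
  simp only [ArithmeticFunction.pmul_apply, hWa, ← div_eq_mul_inv] at hsum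
  refine (half_log_le_sum_chiFour_sq n).trans (hsum.le.trans (sum_le_sum fun d _ => ?_))
  exact mul_le_of_le_one_right (div_nonneg (twoPowOmegaThree_nonneg d) (Nat.cast_nonneg d))
    (sum_chiFour_div_le_one _)

/-- Primes up to `D` that are `3` modulo `4`. -/
noncomputable def primesThree (D : ℕ) : Finset ℕ :=
  (range (D + 1)).filter fun p => p.Prime ∧ p % 4 = 3

/-- Sets of primes `3` modulo `4` whose product is at most `D`. -/
noncomputable def sieveSets (D : ℕ) : Finset (Finset ℕ) :=
  (primesThree D).powerset.filter fun A => ∏ p ∈ A, p ≤ D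

theorem mem_primesThree {D p : ℕ} : p ∈ primesThree D ↔ p ≤ D ∧ p.Prime ∧ p % 4 = 3 := by
  simp [primesThree]

theorem mem_sieveSets {D : ℕ} {A : Finset ℕ} :
    A ∈ sieveSets D ↔ A ⊆ primesThree D ∧ ∏ p ∈ A, p ≤ D := by
  simp [sieveSets]

theorem card_sieveSets_le (D : ℕ) : #(sieveSets D) ≤ D := by
  have hpr : ∀ A ∈ sieveSets D, ∀ p ∈ A, p.Prime := fun A hA p hp =>
    (mem_primesThree.1 ((mem_sieveSets.1 hA).1 hp)).2.1
  calc #(sieveSets D) ≤ #(Ioc 0 D) := by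
        refine card_le_card_of_injOn (fun A => ∏ p ∈ A, p) (fun A hA => ?_) fun A hA B hB hAB => ?_
        · simp only [coe_Ioc, Set.mem_Ioc]
          exact ⟨prod_pos fun p hp => (hpr A hA p hp).pos, (mem_sieveSets.1 hA).2⟩
        · rw [← Nat.primeFactors_prod (hpr A hA), ← Nat.primeFactors_prod (hpr B hB)]
          exact congrArg Nat.primeFactors hAB
    _ = D := by simp

theorem twoPowOmegaThree_le_card_divisors (n : ℕ) : twoPowOmegaThree n ≤ #n.divisors := by
  rcases eq_or_ne n 0 with rfl | hn
  · simp
  · rw [twoPowOmegaThree, ArithmeticFunction.prodPrimeFactors_apply hn, Nat.card_divisors hn]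
    push_cast
    refine prod_le_prod (fun p _ => by split_ifs <;> norm_num) fun p hp => ?_
    have h : 1 ≤ n.factorization p :=
      (Nat.prime_of_mem_primeFactors hp).factorization_pos_of_dvd hn
        (Nat.dvd_of_mem_primeFactors hp)
    have h : (1 : ℝ) ≤ n.factorization p := by exact_mod_cast h
    split_ifs <;> linarith

theorem twoPowOmegaThree_sq_mul_le {r t : ℕ} (hr : r ≠ 0) (ht : t ≠ 0) :
    twoPowOmegaThree (t ^ 2 * r) ≤ twoPowOmegaThree r * twoPowOmegaThree t := by
  rw [twoPowOmegaThree, ArithmeticFunction.prodPrimeFactors_apply hr,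
    ArithmeticFunction.prodPrimeFactors_apply ht,
    ArithmeticFunction.prodPrimeFactors_apply (mul_ne_zero (pow_ne_zero 2 ht) hr),
    Nat.primeFactors_mul (pow_ne_zero 2 ht) hr, Nat.primeFactors_pow t two_ne_zero, union_comm]
  set g : ℕ → ℝ := fun p => if p % 4 = 3 then 2 else 0 with hg
  have hg0 : ∀ p, 0 ≤ g p := fun p => by
    simp only [hg]
    split_ifs <;> norm_num
  by_cases h : ∀ p ∈ r.primeFactors ∪ t.primeFactors, p % 4 = 3
  · rw [← prod_union_inter]
    refine le_mul_of_one_le_right (prod_nonneg fun p _ => hg0 p) ?_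
    rw [prod_congr rfl fun p hp => if_pos (h p (mem_union_left _ (mem_inter.1 hp).1)), prod_const]
    exact one_le_pow₀ one_le_two
  · push Not at h
    obtain ⟨p, hp, hp3⟩ := h
    rw [prod_eq_zero hp (by simp [hp3])]
    exact mul_nonneg (prod_nonneg fun p _ => hg0 p) (prod_nonneg fun p _ => hg0 p)

theorem sum_Ioc_inv_sq_le_two (n : ℕ) : ∑ d ∈ Ioc 0 n, ((d : ℝ) ^ 2)⁻¹ ≤ 2 := by
  have := sum_Ioo_inv_sq_le (α := ℝ) 0 (n + 1)
  have e : Ioo 0 (n + 1) = Ioc 0 n := by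
    ext
    simp
  rw [e] at this
  simpa using this

theorem sum_card_divisors_div_sq_le (n : ℕ) :
    ∑ t ∈ Ioc 0 n, (#t.divisors : ℝ) / (t : ℝ) ^ 2 ≤ 4 := by
  set W : ArithmeticFunction ℝ := ⟨fun n => ((n : ℝ) ^ 2)⁻¹, by simp⟩ with hW
  have hWa (n : ℕ) : W n = ((n : ℝ) ^ 2)⁻¹ := rfl
  have hconv (t : ℕ) : (W * W) t = (#t.divisors : ℝ) / (t : ℝ) ^ 2 := by
    rw [ArithmeticFunction.mul_apply, div_eq_mul_inv, ← nsmul_eq_mul, ← sum_const,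
      ← Nat.sum_divisorsAntidiagonal (fun _ _ => ((t : ℝ) ^ 2)⁻¹)]
    refine sum_congr rfl fun x hx => ?_
    rw [← (Nat.mem_divisorsAntidiagonal.1 hx).1, hWa, hWa]
    push_cast
    rw [mul_pow, mul_inv]
  have hsum := ArithmeticFunction.sum_Ioc_mul_eq_sum_sum W W n
  simp only [hconv] at hsum
  rw [hsum]
  calc ∑ d ∈ Ioc 0 n, W d * ∑ m ∈ Ioc 0 (n / d), W m ≤ ∑ d ∈ Ioc 0 n, W d * 2 :=
        sum_le_sum fun d _ => mul_le_mul_of_nonneg_left (sum_Ioc_inv_sq_le_two _) (by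
          rw [hWa]
          positivity)
    _ = (∑ d ∈ Ioc 0 n, W d) * 2 := by rw [sum_mul]
    _ ≤ 4 := by
        have : ∑ d ∈ Ioc 0 n, W d ≤ 2 := sum_Ioc_inv_sq_le_two n
        linarith

theorem sum_squarefree_twoPowOmegaThree_le (D : ℕ) :
    ∑ r ∈ (Ioc 0 D).filter Squarefree, twoPowOmegaThree r / r ≤
      ∑ A ∈ sieveSets D, ∏ p ∈ A, 2 / (p : ℝ) := by
  set R := ((Ioc 0 D).filter Squarefree).filter fun r => twoPowOmegaThree r ≠ 0 with hR
  have hmem : ∀ r ∈ R, (0 < r ∧ r ≤ D) ∧ Squarefree r ∧ ∀ p ∈ r.primeFactors, p % 4 = 3 := by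
    intro r hr
    simp only [hR, mem_filter, mem_Ioc] at hr
    refine ⟨hr.1.1, hr.1.2, fun p hp => ?_⟩
    by_contra hp3
    refine hr.2 ?_
    rw [twoPowOmegaThree, ArithmeticFunction.prodPrimeFactors_apply hr.1.1.1.ne']
    exact prod_eq_zero hp (if_neg hp3)
  have hval : ∀ r ∈ R, twoPowOmegaThree r / r = ∏ p ∈ r.primeFactors, 2 / (p : ℝ) := by
    intro r hr
    obtain ⟨⟨h0, _⟩, hsq, h3⟩ := hmem r hr
    rw [prod_div_distrib, twoPowOmegaThree, ArithmeticFunction.prodPrimeFactors_apply h0.ne']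
    congr 1
    · exact prod_congr rfl fun p hp => if_pos (h3 p hp)
    · rw [← Nat.cast_prod, Nat.prod_primeFactors_of_squarefree hsq]
  have hinj : Set.InjOn Nat.primeFactors (R : Set ℕ) := fun r hr s hs h => by
    rw [← Nat.prod_primeFactors_of_squarefree (hmem r hr).2.1,
      ← Nat.prod_primeFactors_of_squarefree (hmem s hs).2.1, h]
  calc ∑ r ∈ (Ioc 0 D).filter Squarefree, twoPowOmegaThree r / r
      = ∑ r ∈ R, twoPowOmegaThree r / r := by
        refine (sum_filter_of_ne (p := fun r => twoPowOmegaThree r ≠ 0) fun r _ hr h => hr ?_).symm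
        rw [h, zero_div]
    _ = ∑ r ∈ R, ∏ p ∈ r.primeFactors, 2 / (p : ℝ) := sum_congr rfl hval
    _ = ∑ A ∈ R.image Nat.primeFactors, ∏ p ∈ A, 2 / (p : ℝ) :=
        (sum_image (f := fun A : Finset ℕ => ∏ p ∈ A, 2 / (p : ℝ)) hinj).symm
    _ ≤ ∑ A ∈ sieveSets D, ∏ p ∈ A, 2 / (p : ℝ) := by
        refine sum_le_sum_of_subset_of_nonneg (fun A hA => ?_)
          fun A _ _ => prod_nonneg fun p _ => by positivity
        obtain ⟨r, hr, rfl⟩ := mem_image.1 hA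
        obtain ⟨⟨h0, hD⟩, hsq, h3⟩ := hmem r hr
        refine mem_sieveSets.2 ⟨fun p hp => mem_primesThree.2
          ⟨(Nat.le_of_mem_primeFactors hp).trans hD, Nat.prime_of_mem_primeFactors hp, h3 p hp⟩, ?_⟩
        rwa [Nat.prod_primeFactors_of_squarefree hsq]

theorem log_le_sum_sieveSets (D : ℕ) :
    Real.log D ≤ 8 * ∑ A ∈ sieveSets D, ∏ p ∈ A, 2 / (p : ℝ) := by
  have hdec : ∀ n ∈ Ioc 0 D, ∃ rt : ℕ × ℕ, rt ∈ (Ioc 0 D).filter Squarefree ×ˢ Ioc 0 D ∧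
      rt.2 ^ 2 * rt.1 = n := by
    intro n hn
    obtain ⟨h0, hnD⟩ := mem_Ioc.1 hn
    obtain ⟨r, t, hr, ht, hrt, hsq⟩ := Nat.sq_mul_squarefree_of_pos h0
    refine ⟨(r, t), ?_, hrt⟩
    have h1 : r ≤ n := hrt ▸ Nat.le_mul_of_pos_left r (pow_pos ht 2)
    have h2 : t ≤ n := (Nat.le_self_pow two_ne_zero t).trans
      (hrt ▸ Nat.le_mul_of_pos_right (t ^ 2) hr)
    simp [hr, ht, hsq, h1.trans hnD, h2.trans hnD]
  choose! φ hφ hφn using hdec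
  have hinj : Set.InjOn φ (Ioc 0 D : Set ℕ) := fun m hm n hn h => by
    rw [← hφn m hm, ← hφn n hn, h]
  set ψ : ℕ × ℕ → ℝ := fun x =>
    twoPowOmegaThree x.1 / x.1 * ((#x.2.divisors : ℝ) / (x.2 : ℝ) ^ 2) with hψ
  have hψ0 : ∀ x, 0 ≤ ψ x := fun x =>
    mul_nonneg (div_nonneg (twoPowOmegaThree_nonneg _) (Nat.cast_nonneg _)) (by positivity)
  have h1 : ∑ n ∈ Ioc 0 D, twoPowOmegaThree n / n ≤
      (∑ r ∈ (Ioc 0 D).filter Squarefree, twoPowOmegaThree r / r) * 4 := by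
    calc ∑ n ∈ Ioc 0 D, twoPowOmegaThree n / n ≤ ∑ n ∈ Ioc 0 D, ψ (φ n) := by
          refine sum_le_sum fun n hn => ?_
          have hm := hφ n hn
          simp only [mem_product, mem_filter, mem_Ioc] at hm
          have hr : (φ n).1 ≠ 0 := hm.1.1.1.ne'
          have ht : (φ n).2 ≠ 0 := hm.2.1.ne'
          conv_lhs => rw [← hφn n hn]
          simp only [hψ]
          push_cast
          rw [div_mul_div_comm, mul_comm ((φ n).1 : ℝ)]
          gcongr
          refine (twoPowOmegaThree_sq_mul_le hr ht).trans ?_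
          exact mul_le_mul_of_nonneg_left (twoPowOmegaThree_le_card_divisors _)
            (twoPowOmegaThree_nonneg _)
      _ = ∑ x ∈ (Ioc 0 D).image φ, ψ x := (sum_image hinj).symm
      _ ≤ ∑ x ∈ (Ioc 0 D).filter Squarefree ×ˢ Ioc 0 D, ψ x :=
          sum_le_sum_of_subset_of_nonneg (image_subset_iff.2 hφ) fun x _ _ => hψ0 x
      _ = (∑ r ∈ (Ioc 0 D).filter Squarefree, twoPowOmegaThree r / r) *
            ∑ t ∈ Ioc 0 D, (#t.divisors : ℝ) / (t : ℝ) ^ 2 := by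
          rw [sum_mul_sum, ← sum_product']
      _ ≤ _ := mul_le_mul_of_nonneg_left (sum_card_divisors_div_sq_le D)
          (sum_nonneg fun r _ => div_nonneg (twoPowOmegaThree_nonneg _) (Nat.cast_nonneg _))
  have h2 := half_log_le_sum_twoPowOmegaThree D
  have h3 := sum_squarefree_twoPowOmegaThree_le D
  linarith

theorem sum_log_div_prime_le (z : ℕ) :
    ∑ p ∈ (Ioc 0 z).filter Nat.Prime, Real.log p / p ≤ Real.log z + Real.log 4 := by
  rcases Nat.eq_zero_or_pos z with rfl | hz
  · simp [Real.log_nonneg]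
  have hz' : (0 : ℝ) < z := by exact_mod_cast hz
  have hsum := ArithmeticFunction.sum_Ioc_mul_zeta_eq_sum ArithmeticFunction.vonMangoldt z
  rw [ArithmeticFunction.vonMangoldt_mul_zeta] at hsum
  have hup : ∑ n ∈ Ioc 0 z, ArithmeticFunction.log n ≤ z * Real.log z := by
    calc ∑ n ∈ Ioc 0 z, ArithmeticFunction.log n ≤ ∑ n ∈ Ioc 0 z, Real.log z :=
          sum_le_sum fun n hn => by
            obtain ⟨h0, h1⟩ := mem_Ioc.1 hn
            exact Real.log_le_log (by exact_mod_cast h0) (by exact_mod_cast h1)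
      _ = z * Real.log z := by simp
  have hlow : ∑ p ∈ (Ioc 0 z).filter Nat.Prime, Real.log p * ((z : ℝ) / p - 1) ≤
      ∑ n ∈ Ioc 0 z, ArithmeticFunction.vonMangoldt n * ((z / n : ℕ) : ℝ) := by
    rw [sum_filter]
    refine sum_le_sum fun n hn => ?_
    split_ifs with hp
    · rw [ArithmeticFunction.vonMangoldt_apply_prime hp]
      refine mul_le_mul_of_nonneg_left ?_ (Real.log_natCast_nonneg n)
      rw [← Nat.floor_div_eq_div (K := ℝ)]
      exact (Nat.sub_one_lt_floor _).le
    · exact mul_nonneg ArithmeticFunction.vonMangoldt_nonneg (Nat.cast_nonneg _)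
  have htheta : ∑ p ∈ (Ioc 0 z).filter Nat.Prime, Real.log p ≤ Real.log 4 * z := by
    have := Chebyshev.theta_le_log4_mul_x (x := z) hz'.le
    rwa [Chebyshev.theta, Nat.floor_natCast] at this
  have hexp : ∑ p ∈ (Ioc 0 z).filter Nat.Prime, Real.log p * ((z : ℝ) / p - 1) =
      z * ∑ p ∈ (Ioc 0 z).filter Nat.Prime, Real.log p / p -
        ∑ p ∈ (Ioc 0 z).filter Nat.Prime, Real.log p := by
    rw [mul_sum, ← sum_sub_distrib]
    exact sum_congr rfl fun p _ => by ring
  have : z * ∑ p ∈ (Ioc 0 z).filter Nat.Prime, Real.log p / p ≤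
      z * (Real.log z + Real.log 4) := by linarith
  exact le_of_mul_le_mul_left this hz'

/-- Mertens' upper bound for the sum of reciprocals of primes. -/
theorem sum_inv_prime_le {z : ℕ} (hz : 2 ≤ z) :
    ∑ p ∈ (Ioc 0 z).filter Nat.Prime, 1 / (p : ℝ) ≤ Real.log (Real.log z) + 4 := by
  set c := Real.log 4 with hc
  have hlog2 : 0 < Real.log 2 := Real.log_pos one_lt_two
  have hc2 : c = 2 * Real.log 2 := by
    rw [hc, show (4 : ℝ) = 2 ^ 2 by norm_num, Real.log_pow]
    norm_num
  have key : ∑ p ∈ (Ioc 0 z).filter Nat.Prime, 1 / (p : ℝ) -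
      (∑ p ∈ (Ioc 0 z).filter Nat.Prime, Real.log p / p) / Real.log z ≤
      Real.log (Real.log z) + c * (1 / Real.log 2 - 1 / Real.log z) + 1 := by
    induction z, hz using Nat.le_induction with
    | base =>
      have h2 : (Ioc 0 2).filter Nat.Prime = {2} := by decide
      have hll : -1 ≤ Real.log (Real.log 2) := by
        rw [Real.le_log_iff_exp_le hlog2]
        have h1 := Real.exp_one_gt_d9
        have h2 := Real.log_two_gt_d9
        rw [Real.exp_neg, inv_le_comm₀ (Real.exp_pos 1) hlog2]
        rw [inv_le_comm₀ hlog2 (Real.exp_pos 1)]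
        calc (Real.exp 1)⁻¹ ≤ (2.7)⁻¹ := by
              gcongr
              linarith
          _ ≤ 0.69 := by norm_num
          _ ≤ Real.log 2 := by linarith
      rw [h2]
      simp only [sum_singleton, Nat.cast_ofNat, sub_self, mul_zero]
      have : Real.log 2 / 2 / Real.log 2 = 1 / 2 := by field_simp
      rw [this]
      linarith
    | succ n hn ih =>
      have hn' : (2 : ℝ) ≤ n := by exact_mod_cast hn
      have hx : 0 < Real.log n := Real.log_pos (by linarith)
      have hxy : Real.log n ≤ Real.log (n + 1 : ℕ) :=
        Real.log_le_log (by linarith) (by push_cast; linarith)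
      have hA := sum_log_div_prime_le n
      set A := ∑ p ∈ (Ioc 0 n).filter Nat.Prime, Real.log p / p with hAdef
      set x := Real.log n
      set y := Real.log (n + 1 : ℕ) with hy
      have hy0 : 0 < y := hx.trans_le hxy
      have hstep : A * (1 / x - 1 / y) ≤
          (Real.log y - Real.log x) + c * (1 / x - 1 / y) := by
        have hd : 0 ≤ 1 / x - 1 / y := sub_nonneg.2 (one_div_le_one_div_of_le hx hxy)
        have h1 : A * (1 / x - 1 / y) ≤ (x + c) * (1 / x - 1 / y) :=
          mul_le_mul_of_nonneg_right hA hd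
        have h2 : 1 - x / y ≤ Real.log y - Real.log x := by
          rw [← Real.log_div hy0.ne' hx.ne']
          have := Real.one_sub_inv_le_log_of_pos (div_pos hy0 hx)
          rwa [inv_div] at this
        have h3 : x * (1 / x - 1 / y) = 1 - x / y := by
          field_simp
        linarith [add_mul x c (1 / x - 1 / y)]
      have hins : (Ioc 0 (n + 1)).filter Nat.Prime = if (n + 1).Prime then
          insert (n + 1) ((Ioc 0 n).filter Nat.Prime) else (Ioc 0 n).filter Nat.Prime := by
        rw [← insert_Ioc_right_eq_Ioc_add_one (Nat.zero_le n), filter_insert]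
      have hnot : n + 1 ∉ (Ioc 0 n).filter Nat.Prime := by simp
      have hEq : ∑ p ∈ (Ioc 0 (n + 1)).filter Nat.Prime, 1 / (p : ℝ) -
          (∑ p ∈ (Ioc 0 (n + 1)).filter Nat.Prime, Real.log p / p) / y =
          ∑ p ∈ (Ioc 0 n).filter Nat.Prime, 1 / (p : ℝ) - A / y := by
        rw [hins]
        split_ifs
        · rw [sum_insert hnot, sum_insert hnot, ← hy, ← hAdef]
          field_simp
          ring
        · rfl
      rw [hEq]
      have : A / y = A / x - A * (1 / x - 1 / y) := by ring
      rw [this]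
      have e1 : c * (1 / Real.log 2 - 1 / y) =
        c * (1 / Real.log 2 - 1 / x) + c * (1 / x - 1 / y) := by ring
      linarith
  have hz' : (2 : ℝ) ≤ z := by exact_mod_cast hz
  have hx : 0 < Real.log z := Real.log_pos (by linarith)
  have hA : (∑ p ∈ (Ioc 0 z).filter Nat.Prime, Real.log p / p) / Real.log z ≤
      1 + c * (1 / Real.log z) := by
    rw [div_le_iff₀ hx]
    refine (sum_log_div_prime_le z).trans (le_of_eq ?_)
    field_simp
    rw [hc]
  have hcc : c * (1 / Real.log 2) = 2 := by
    rw [hc2]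
    field_simp
  rw [mul_sub, hcc] at key
  linarith

theorem card_primeFactors_le_log {h : ℕ} (hh : h ≠ 0) :
    #h.primeFactors * Real.log 2 ≤ Real.log h := by
  have h1 : 2 ^ #h.primeFactors ≤ h :=
    calc 2 ^ #h.primeFactors ≤ ∏ p ∈ h.primeFactors, p :=
          prod_const (M := ℕ) 2 ▸ prod_le_prod (fun _ _ => Nat.zero_le 2)
            fun p hp => (Nat.prime_of_mem_primeFactors hp).two_le
      _ ≤ h := Nat.le_of_dvd (Nat.pos_of_ne_zero hh) (Nat.prod_primeFactors_dvd h)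
  rw [← Real.log_pow]
  exact Real.log_le_log (by positivity) (by exact_mod_cast h1)

theorem sum_inv_primeFactors_le {h : ℕ} (hh : 3 ≤ h) :
    ∑ p ∈ h.primeFactors, 1 / (p : ℝ) ≤ Real.log (Real.log (Real.log h + 1)) + 6 := by
  have hh' : (3 : ℝ) ≤ h := by exact_mod_cast hh
  have hL : 1 ≤ Real.log h := by
    rw [Real.le_log_iff_exp_le (by linarith)]
    linarith [Real.exp_one_lt_d9]
  set z := ⌊Real.log h⌋₊ + 1 with hz
  have hz2 : 2 ≤ z := by
    have : 1 ≤ ⌊Real.log h⌋₊ := Nat.one_le_floor_iff _ |>.2 hL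
    omega
  have hzL : Real.log h < z := by
    rw [hz]
    push_cast
    exact Nat.lt_floor_add_one _
  have hzL' : (z : ℝ) ≤ Real.log h + 1 := by
    rw [hz]
    push_cast
    linarith [Nat.floor_le (zero_le_one.trans hL)]
  have hz2' : (2 : ℝ) ≤ z := by exact_mod_cast hz2
  rw [← sum_filter_add_sum_filter_not h.primeFactors (fun p => p ≤ z)]
  have hsmall : ∑ p ∈ h.primeFactors with p ≤ z, 1 / (p : ℝ) ≤
      Real.log (Real.log (Real.log h + 1)) + 4 :=
    calc ∑ p ∈ h.primeFactors with p ≤ z, 1 / (p : ℝ)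
        ≤ ∑ p ∈ (Ioc 0 z).filter Nat.Prime, 1 / (p : ℝ) := by
          refine sum_le_sum_of_subset_of_nonneg (fun p hp => ?_) fun p _ _ => by positivity
          obtain ⟨hp, hpz⟩ := mem_filter.1 hp
          have := Nat.prime_of_mem_primeFactors hp
          exact mem_filter.2 ⟨mem_Ioc.2 ⟨this.pos, hpz⟩, this⟩
      _ ≤ Real.log (Real.log z) + 4 := sum_inv_prime_le hz2
      _ ≤ _ := by
          have h0 : 0 < Real.log z := Real.log_pos (by linarith)
          gcongr
  have hlarge : ∑ p ∈ h.primeFactors with ¬ p ≤ z, 1 / (p : ℝ) ≤ 2 :=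
    calc ∑ p ∈ h.primeFactors with ¬ p ≤ z, 1 / (p : ℝ)
        ≤ ∑ p ∈ h.primeFactors with ¬ p ≤ z, 1 / Real.log h := by
          refine sum_le_sum fun p hp => one_div_le_one_div_of_le (by linarith) ?_
          have : (z : ℝ) < p := by exact_mod_cast not_le.1 (mem_filter.1 hp).2
          linarith
      _ ≤ ∑ p ∈ h.primeFactors, 1 / Real.log h :=
          sum_le_sum_of_subset_of_nonneg (filter_subset _ _) fun p _ _ => by positivity
      _ = #h.primeFactors / Real.log h := by
          rw [sum_const, nsmul_eq_mul, mul_one_div]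
      _ ≤ 2 := by
          rw [div_le_iff₀ (by linarith)]
          nlinarith [card_primeFactors_le_log (by omega : h ≠ 0), Real.log_two_gt_d9,
            Nat.cast_nonneg (α := ℝ) #h.primeFactors]
  linarith

/-- Indicator of the natural numbers that `p` divides exactly once. -/
noncomputable def exactDvd (p m : ℕ) : ℝ := if p ∣ m ∧ ¬ p ^ 2 ∣ m then 1 else 0

theorem exactDvd_periodic (p : ℕ) : Function.Periodic (exactDvd p) (p ^ 2) := fun m => by
  simp only [exactDvd, Nat.dvd_add_self_right,
    Nat.dvd_add_left (dvd_pow_self p two_ne_zero)]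

theorem sum_range_exactDvd {p : ℕ} (hp : p.Prime) :
    ∑ m ∈ range (p ^ 2), exactDvd p m = p - 1 := by
  have hset : (range (p ^ 2)).filter (fun m => p ∣ m ∧ ¬ p ^ 2 ∣ m) =
      (Ioo 0 p).image (p * ·) := by
    ext m
    simp only [mem_filter, mem_range, mem_image, mem_Ioo]
    constructor
    · rintro ⟨hm, ⟨c, rfl⟩, hc⟩
      refine ⟨c, ⟨Nat.pos_of_ne_zero fun h0 => hc (by simp [h0]), ?_⟩, rfl⟩
      exact lt_of_mul_lt_mul_left (by rwa [← sq]) (Nat.zero_le p)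
    · rintro ⟨c, ⟨h0, hc⟩, rfl⟩
      refine ⟨by rw [sq]; exact Nat.mul_lt_mul_of_pos_left hc hp.pos, dvd_mul_right p c, ?_⟩
      rw [sq, Nat.mul_dvd_mul_iff_left hp.pos]
      exact Nat.not_dvd_of_pos_of_lt h0 hc
  simp only [exactDvd]
  rw [sum_boole, hset, card_image_of_injective _ (mul_right_injective₀ hp.ne_zero),
    Nat.card_Ioo, Nat.sub_zero, Nat.cast_sub hp.one_le, Nat.cast_one]

theorem sum_range_add_of_periodic {F : ℕ → ℝ} {q : ℕ} (hF : Function.Periodic F q) (h : ℕ) :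
    ∑ m ∈ range q, F (m + h) = ∑ m ∈ range q, F m := by
  induction h with
  | zero => simp
  | succ h ih =>
    have h1 := sum_range_succ (fun m => F (m + h)) q
    rw [sum_range_succ', zero_add, add_comm q h, hF h] at h1
    rw [← ih, ← add_right_cancel h1]
    exact sum_congr rfl fun m _ => by rw [add_right_comm, add_assoc]

theorem exactDvd_eq_zero {p m : ℕ} (hp : p.Prime) (hp3 : p % 4 = 3) (hm : b m = 1) :
    exactDvd p m = 0 := by
  rcases eq_or_ne m 0 with rfl | hm0
  · simp [exactDvd]
  have hsq : IsSumTwoSquares m := by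
    by_contra h
    simp [b, h] at hm
  refine if_neg fun ⟨h1, h2⟩ => h2 ?_
  obtain ⟨x, y, hxy⟩ := hsq
  have hnat : ∃ x y : ℕ, m = x ^ 2 + y ^ 2 := by
    refine ⟨x.natAbs, y.natAbs, ?_⟩
    zify
    simpa using hxy
  have heven := Nat.eq_sq_add_sq_iff.1 hnat p (Nat.mem_primeFactors.2 ⟨hp, h1, hm0⟩) hp3
  have : Fact p.Prime := ⟨hp⟩
  have h1 := one_le_padicValNat_of_dvd hm0 h1
  rw [padicValNat_dvd_iff_le hm0]
  obtain ⟨k, hk⟩ := heven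
  omega

/-- Indicator of the residues modulo `p ^ 2` at which `p` exactly divides `m` or `m + h`. -/
noncomputable def pairWeight (h p m : ℕ) : ℝ :=
  exactDvd p m + if p ∣ h then 0 else exactDvd p (m + h)

/-- The number of residues modulo `p ^ 2` counted by `pairWeight`. -/
noncomputable def pairCount (h p : ℕ) : ℝ := if p ∣ h then (p : ℝ) - 1 else 2 * ((p : ℝ) - 1)

theorem pairWeight_eq_zero_or_one (h p m : ℕ) : pairWeight h p m = 0 ∨ pairWeight h p m = 1 := by
  simp only [pairWeight, exactDvd]
  by_cases hh : p ∣ h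
  · simp only [if_pos hh, add_zero]
    split_ifs <;> simp
  · rw [if_neg hh]
    by_cases hm : p ∣ m
    · have : ¬ p ∣ m + h := fun h' => hh ((Nat.dvd_add_right hm).1 h')
      simp only [this, false_and, if_false, add_zero]
      split_ifs <;> simp
    · simp only [hm, false_and, if_false, zero_add]
      split_ifs <;> simp

theorem pairWeight_periodic (h p : ℕ) : Function.Periodic (pairWeight h p) (p ^ 2) := fun m => by
  simp only [pairWeight]
  rw [exactDvd_periodic p m, add_right_comm, exactDvd_periodic p (m + h)]

theorem sum_range_pairWeight (h : ℕ) {p : ℕ} (hp : p.Prime) :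
    ∑ m ∈ range (p ^ 2), pairWeight h p m = pairCount h p := by
  simp only [pairWeight, pairCount]
  rw [sum_add_distrib, sum_range_exactDvd hp]
  split_ifs
  · simp
  · rw [sum_range_add_of_periodic (exactDvd_periodic p), sum_range_exactDvd hp]
    ring

theorem pairCount_pos (h : ℕ) {p : ℕ} (hp : p.Prime) : 0 < pairCount h p := by
  have : (1 : ℝ) < p := by exact_mod_cast hp.one_lt
  unfold pairCount
  split_ifs <;> linarith

theorem two_mul_pairCount_le (h : ℕ) {p : ℕ} (hp : p.Prime) : 2 * pairCount h p ≤ (p : ℝ) ^ 2 := by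
  have : (1 : ℝ) < p := by exact_mod_cast hp.one_lt
  unfold pairCount
  split_ifs <;> nlinarith [sq_nonneg ((p : ℝ) - 2)]

/-- The Selberg weight at `p` attached to `pairCount`. -/
noncomputable def pairRatio (h p : ℕ) : ℝ := pairCount h p / ((p : ℝ) ^ 2 - pairCount h p)

theorem pairRatio_nonneg (h : ℕ) {p : ℕ} (hp : p.Prime) : 0 ≤ pairRatio h p := by
  have h1 := pairCount_pos h hp
  have h2 := two_mul_pairCount_le h hp
  exact div_nonneg h1.le (by linarith)

theorem two_div_le_pairRatio_add (h : ℕ) {p : ℕ} (hp : p.Prime) :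
    2 / (p : ℝ) ≤ pairRatio h p + if p ∣ h then 1 / (p : ℝ) + ((p : ℝ) ^ 2)⁻¹ else 0 := by
  have h1 : (1 : ℝ) < p := by exact_mod_cast hp.one_lt
  have hpos := pairCount_pos h hp
  have h2 := two_mul_pairCount_le h hp
  have hp0 : (0 : ℝ) < p := by linarith
  have hden : 0 < (p : ℝ) ^ 2 - pairCount h p := by linarith
  unfold pairRatio
  by_cases hh : p ∣ h
  · rw [if_pos hh]
    have h3 : pairCount h p / (p : ℝ) ^ 2 ≤ pairCount h p / ((p : ℝ) ^ 2 - pairCount h p) :=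
      div_le_div_of_nonneg_left hpos.le hden (by linarith)
    have h4 : pairCount h p / (p : ℝ) ^ 2 = 1 / (p : ℝ) - ((p : ℝ) ^ 2)⁻¹ := by
      rw [pairCount, if_pos hh]
      field_simp
    have h5 : 2 / (p : ℝ) = 1 / p + 1 / p := by ring
    linarith
  · rw [if_neg hh, add_zero, div_le_div_iff₀ hp0 hden]
    rw [pairCount, if_neg hh]
    have : (2 : ℝ) ≤ p := by exact_mod_cast hp.two_le
    nlinarith

theorem sum_sieveSets_prod_add_le {D : ℕ} {f v : ℕ → ℝ} (hf : ∀ p ∈ primesThree D, 0 ≤ f p)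
    (hv : ∀ p ∈ primesThree D, 0 ≤ v p) :
    ∑ A ∈ sieveSets D, ∏ p ∈ A, (f p + v p) ≤
      (∑ A ∈ sieveSets D, ∏ p ∈ A, f p) * ∏ p ∈ primesThree D, (1 + v p) := by
  have hexp : ∏ p ∈ primesThree D, (1 + v p) =
      ∑ E ∈ (primesThree D).powerset, ∏ p ∈ E, v p := prod_one_add (primesThree D)
  rw [hexp, sum_mul_sum, ← sum_product']
  simp only [prod_add]
  rw [sum_sigma']
  rw [← sum_image (s := (sieveSets D).sigma fun A => A.powerset)
    (g := fun x : (_ : Finset ℕ) × Finset ℕ => (x.2, x.1 \ x.2))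
    (f := fun y : Finset ℕ × Finset ℕ => (∏ p ∈ y.1, f p) * ∏ p ∈ y.2, v p)]
  · refine sum_le_sum_of_subset_of_nonneg ?_ ?_
    · intro y hy
      obtain ⟨⟨A, B⟩, hx, rfl⟩ := mem_image.1 hy
      obtain ⟨hA, hB⟩ := mem_sigma.1 hx
      rw [mem_powerset] at hB
      obtain ⟨hA1, hA2⟩ := mem_sieveSets.1 hA
      refine mem_product.2 ⟨mem_sieveSets.2 ⟨hB.trans hA1, le_trans ?_ hA2⟩,
        mem_powerset.2 (sdiff_subset.trans hA1)⟩
      exact prod_le_prod_of_subset_of_one_le' hB fun p hp _ =>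
        (mem_primesThree.1 (hA1 hp)).2.1.one_le
    · rintro ⟨B, E⟩ hy _
      obtain ⟨hB, hE⟩ := mem_product.1 hy
      exact mul_nonneg (prod_nonneg fun p hp => hf p ((mem_sieveSets.1 hB).1 hp))
        (prod_nonneg fun p hp => hv p (mem_powerset.1 hE hp))
  · rintro ⟨A, B⟩ hx ⟨A', B'⟩ hx' heq
    simp only [coe_sigma, Set.mem_sigma_iff, mem_coe, mem_powerset] at hx hx'
    simp only [Prod.mk.injEq] at heq
    obtain ⟨rfl, h2⟩ := heq
    have : A = A' := by
      rw [← union_sdiff_of_subset hx.2, h2, union_sdiff_of_subset hx'.2]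
    rw [this]

theorem prod_one_add_ite_dvd_le {h : ℕ} (hh : 3 ≤ h) (D : ℕ) :
    ∏ p ∈ primesThree D, (1 + if p ∣ h then 1 / (p : ℝ) + ((p : ℝ) ^ 2)⁻¹ else 0) ≤
      Real.exp 8 * Real.log (Real.log h + 1) := by
  have hlog : 0 < Real.log h := Real.log_pos (by exact_mod_cast (by omega : 1 < h))
  have hsum : ∑ p ∈ primesThree D, (if p ∣ h then 1 / (p : ℝ) + ((p : ℝ) ^ 2)⁻¹ else 0) ≤
      8 + Real.log (Real.log (Real.log h + 1)) := by
    rw [← sum_filter, sum_add_distrib]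
    have h1 : ∑ p ∈ (primesThree D).filter (· ∣ h), 1 / (p : ℝ) ≤
        ∑ p ∈ h.primeFactors, 1 / (p : ℝ) := by
      refine sum_le_sum_of_subset_of_nonneg (fun p hp => ?_) fun p _ _ => by positivity
      obtain ⟨hp, hph⟩ := mem_filter.1 hp
      exact Nat.mem_primeFactors.2 ⟨(mem_primesThree.1 hp).2.1, hph, by omega⟩
    have h2 : ∑ p ∈ (primesThree D).filter (· ∣ h), ((p : ℝ) ^ 2)⁻¹ ≤
        ∑ p ∈ Ioc 0 D, ((p : ℝ) ^ 2)⁻¹ := by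
      refine sum_le_sum_of_subset_of_nonneg (fun p hp => ?_) fun p _ _ => by positivity
      obtain ⟨hpD, hp, -⟩ := mem_primesThree.1 (mem_filter.1 hp).1
      exact mem_Ioc.2 ⟨hp.pos, hpD⟩
    linarith [sum_inv_primeFactors_le hh, sum_Ioc_inv_sq_le_two D]
  calc ∏ p ∈ primesThree D, (1 + if p ∣ h then 1 / (p : ℝ) + ((p : ℝ) ^ 2)⁻¹ else 0)
      ≤ ∏ p ∈ primesThree D,
          Real.exp (if p ∣ h then 1 / (p : ℝ) + ((p : ℝ) ^ 2)⁻¹ else 0) := by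
        refine prod_le_prod (fun p _ => ?_) fun p _ => ?_
        · split_ifs <;> positivity
        · rw [add_comm]
          exact Real.add_one_le_exp _
    _ ≤ Real.exp (8 + Real.log (Real.log (Real.log h + 1))) := by
        rw [← Real.exp_sum]
        exact Real.exp_le_exp.2 hsum
    _ = Real.exp 8 * Real.log (Real.log h + 1) := by
        rw [Real.exp_add, Real.exp_log (Real.log_pos (by linarith))]

theorem log_le_sum_prod_pairRatio {h : ℕ} (hh : 3 ≤ h) (D : ℕ) :
    Real.log D ≤ 8 * ((∑ A ∈ sieveSets D, ∏ p ∈ A, pairRatio h p) *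
      (Real.exp 8 * Real.log (Real.log h + 1))) := by
  have hprime : ∀ A ∈ sieveSets D, ∀ p ∈ A, p.Prime := fun A hA p hp =>
    (mem_primesThree.1 ((mem_sieveSets.1 hA).1 hp)).2.1
  have hratio : ∀ p ∈ primesThree D, 0 ≤ pairRatio h p := fun p hp =>
    pairRatio_nonneg h (mem_primesThree.1 hp).2.1
  refine (log_le_sum_sieveSets D).trans (mul_le_mul_of_nonneg_left ?_ (by norm_num))
  calc ∑ A ∈ sieveSets D, ∏ p ∈ A, 2 / (p : ℝ)
      ≤ ∑ A ∈ sieveSets D, ∏ p ∈ A,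
          (pairRatio h p + if p ∣ h then 1 / (p : ℝ) + ((p : ℝ) ^ 2)⁻¹ else 0) :=
        sum_le_sum fun A hA => prod_le_prod (fun p _ => by positivity) fun p hp =>
          two_div_le_pairRatio_add h (hprime A hA p hp)
    _ ≤ _ := sum_sieveSets_prod_add_le hratio fun p _ => by split_ifs <;> positivity
    _ ≤ _ := mul_le_mul_of_nonneg_left (prod_one_add_ite_dvd_le hh D)
        (sum_nonneg fun A hA => prod_nonneg fun p hp => pairRatio_nonneg h (hprime A hA p hp))

/-- Upper bound for the number of pairs of sums of two squares at distance `h`. -/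
theorem card_pairs_le {h D : ℕ} (hh : 3 ≤ h) (hD : 2 ≤ D) (N : ℕ) :
    (#((Icc 1 N).filter fun m => b m = 1 ∧ b (m + h) = 1) : ℝ) ≤
      (N + 1) * (8 * (Real.exp 8 * Real.log (Real.log h + 1))) / Real.log D + (D : ℝ) ^ 6 := by
  set T := (Icc 1 N).filter fun m => b m = 1 ∧ b (m + h) = 1
  set S := ∑ A ∈ sieveSets D, ∏ p ∈ A, pairRatio h p with hS
  have hprime : ∀ p ∈ primesThree D, p.Prime := fun p hp => (mem_primesThree.1 hp).2.1
  have hsieve : (#T : ℝ) * S ^ 2 ≤ (N + 1 : ℕ) * S + (D : ℝ) ^ 4 * (#(sieveSets D) : ℝ) ^ 2 := by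
    refine card_sq_sieve_le hprime (β := pairWeight h) (ρ := pairCount h)
      (fun p _ => pairWeight_eq_zero_or_one h p) (fun p _ => pairWeight_periodic h p)
      (fun p hp => sum_range_pairWeight h (hprime p hp))
      (fun p hp => pairCount_pos h (hprime p hp))
      (fun p hp => two_mul_pairCount_le h (hprime p hp))
      (fun A hA => (mem_sieveSets.1 hA).1) (fun A hA => (mem_sieveSets.1 hA).2) ?_ ?_
    · intro m hm
      have := (mem_Icc.1 (mem_filter.1 hm).1).2
      exact mem_range.2 (by omega)
    · intro m hm p hp
      obtain ⟨-, h1, h2⟩ := mem_filter.1 hm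
      have hp3 := (mem_primesThree.1 hp).2.2
      rw [pairWeight, exactDvd_eq_zero (hprime p hp) hp3 h1,
        exactDvd_eq_zero (hprime p hp) hp3 h2]
      simp
  have hS1 : 1 ≤ S := by
    have hmem : ∅ ∈ sieveSets D := mem_sieveSets.2 ⟨empty_subset _, by simp; omega⟩
    have := single_le_sum (f := fun A => ∏ p ∈ A, pairRatio h p) (fun A hA =>
      prod_nonneg fun p hp => pairRatio_nonneg h (hprime p ((mem_sieveSets.1 hA).1 hp))) hmem
    simpa using this
  have hlogD : 0 < Real.log D := Real.log_pos (by exact_mod_cast (by omega : 1 < D))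
  have hinv : 1 / S ≤ 8 * (Real.exp 8 * Real.log (Real.log h + 1)) / Real.log D := by
    rw [div_le_div_iff₀ (by linarith) hlogD]
    have := log_le_sum_prod_pairRatio hh D
    rw [← hS] at this
    linarith
  have hcard : (#(sieveSets D) : ℝ) ≤ D := by exact_mod_cast card_sieveSets_le D
  have hS2 : 1 ≤ S ^ 2 := one_le_pow₀ hS1
  have hrem : (D : ℝ) ^ 4 * (#(sieveSets D) : ℝ) ^ 2 ≤ (D : ℝ) ^ 6 :=
    calc (D : ℝ) ^ 4 * (#(sieveSets D) : ℝ) ^ 2 ≤ (D : ℝ) ^ 4 * (D : ℝ) ^ 2 := by gcongr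
      _ = (D : ℝ) ^ 6 := by ring
  have hS0 : 0 < S := by linarith
  have hmain : (#T : ℝ) ≤ (N + 1) * (1 / S) + (D : ℝ) ^ 6 := by
    refine le_of_mul_le_mul_right ?_ (pow_pos hS0 2)
    have e : ((N + 1 : ℝ) * (1 / S) + (D : ℝ) ^ 6) * S ^ 2 =
        (N + 1) * S + (D : ℝ) ^ 6 * S ^ 2 := by
      field_simp
    rw [e]
    push_cast at hsieve
    linarith [le_mul_of_one_le_right (by positivity : 0 ≤ (D : ℝ) ^ 6) hS2]
  refine hmain.trans ?_
  rw [mul_div_assoc]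
  gcongr

theorem sum_b_mul_b_eq_card (h N : ℕ) :
    ∑ m ∈ Icc 1 N, b m * b (m + h) =
      #((Icc 1 N).filter fun m => b m = 1 ∧ b (m + h) = 1) := by
  rw [card_filter]
  refine sum_congr rfl fun m _ => ?_
  unfold b
  split_ifs <;> simp_all

theorem sum_b_mul_b_le {n k : ℕ} {L M : ℝ} (hL : L = Real.log n) (hL3 : 3 ≤ L)
    (hM : M = L ^ ((5 : ℝ) / 8)) (hMn : M ≤ n) (hLn : L ≤ (n : ℝ) ^ ((1 : ℝ) / 2))
    (hn2 : 2 ≤ (n : ℝ) ^ ((1 : ℝ) / 24)) (hk : 1 ≤ k) (hkM : (k : ℝ) ≤ M) :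
    ((∑ m ∈ Icc 1 ⌊(n : ℝ) * M⌋₊, b m * b (m + n * k) : ℕ) : ℝ) ≤
      (768 * Real.exp 8 + 1) * (n * M * Real.log L / L) := by
  have hL0 : 0 < L := by linarith
  have hn3 : 3 ≤ n := by
    have : 3 ≤ (n : ℝ) := hL3.trans (hL ▸ Real.log_le_self (Nat.cast_nonneg n))
    exact_mod_cast this
  have hn0 : (0 : ℝ) < n := by exact_mod_cast (by omega : 0 < n)
  have hh : 3 ≤ n * k := hn3.trans (Nat.le_mul_of_pos_right n hk)
  have hM1 : 1 ≤ M := by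
    rw [hM]
    exact Real.one_le_rpow (by linarith) (by norm_num)
  have hlogL : 1 ≤ Real.log L := by
    rw [Real.le_log_iff_exp_le hL0]
    linarith [Real.exp_one_lt_d9]
  have hlogh : Real.log (Real.log (n * k : ℕ) + 1) ≤ 2 * Real.log L := by
    have h1 : Real.log (n * k : ℕ) ≤ 2 * L := by
      push_cast
      rw [Real.log_mul hn0.ne' (by positivity), ← hL]
      have : Real.log k ≤ Real.log n :=
        Real.log_le_log (by exact_mod_cast hk) (hkM.trans hMn)
      linarith
    have h2 : 0 ≤ Real.log (n * k : ℕ) := Real.log_natCast_nonneg _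
    calc Real.log (Real.log (n * k : ℕ) + 1) ≤ Real.log (L ^ 2) :=
          Real.log_le_log (by linarith) (by nlinarith)
      _ = 2 * Real.log L := by
          rw [Real.log_pow]
          norm_num
  set x := (n : ℝ) ^ ((1 : ℝ) / 24) with hx
  set D := ⌊x ^ 2⌋₊ with hD
  have hDx : x ≤ D := by
    have := Nat.lt_floor_add_one (x ^ 2)
    rw [← hD] at this
    nlinarith
  have hD2 : 2 ≤ D := by exact_mod_cast hn2.trans hDx
  have hlogD : L / 24 ≤ Real.log D :=
    calc L / 24 = Real.log x := by
          rw [hx, Real.log_rpow hn0, hL]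
          ring
      _ ≤ Real.log D := Real.log_le_log (by linarith) hDx
  have hD6 : (D : ℝ) ^ 6 ≤ n / L := by
    have h1 : (D : ℝ) ≤ x ^ 2 := Nat.floor_le (by positivity)
    rw [le_div_iff₀ hL0]
    calc (D : ℝ) ^ 6 * L ≤ (x ^ 2) ^ 6 * (n : ℝ) ^ ((1 : ℝ) / 2) := by gcongr
      _ = (n : ℝ) := by
          rw [hx, ← pow_mul, ← Real.rpow_mul_natCast hn0.le, ← Real.rpow_add hn0]
          norm_num
  have hN : (⌊(n : ℝ) * M⌋₊ : ℝ) + 1 ≤ 2 * (n * M) := by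
    have h1 : (⌊(n : ℝ) * M⌋₊ : ℝ) ≤ n * M := Nat.floor_le (by positivity)
    have h2 : (1 : ℝ) ≤ n := by exact_mod_cast (by omega : 1 ≤ n)
    linarith [one_le_mul_of_one_le_of_one_le h2 hM1]
  rw [sum_b_mul_b_eq_card]
  refine (card_pairs_le hh hD2 _).trans ?_
  have e1 : ((⌊(n : ℝ) * M⌋₊ : ℝ) + 1) *
      (8 * (Real.exp 8 * Real.log (Real.log (n * k : ℕ) + 1))) / Real.log D ≤
      2 * (n * M) * (8 * (Real.exp 8 * (2 * Real.log L))) / (L / 24) := by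
    have : 0 ≤ Real.log (Real.log (n * k : ℕ) + 1) :=
      Real.log_nonneg (by linarith [Real.log_natCast_nonneg (n * k)])
    gcongr
  have e2 : (n : ℝ) / L ≤ n * M * Real.log L / L := by
    rw [mul_assoc]
    gcongr
    exact le_mul_of_one_le_right hn0.le (one_le_mul_of_one_le_of_one_le hM1 hlogL)
  calc _ ≤ 2 * (n * M) * (8 * (Real.exp 8 * (2 * Real.log L))) / (L / 24) +
        n * M * Real.log L / L := add_le_add e1 (hD6.trans e2)
    _ = _ := by
      field_simp
      ring

/-- There is `C > 0` with `G(n) ≤ C·n·(log n)^{1/4}·(log log n)` for all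
sufficiently large `n`. -/
theorem G_upper_bound :
    ∃ C : ℝ, 0 < C ∧
      ∀ᶠ n : ℕ in atTop,
        (G n : ℝ) ≤ C * n * Real.log n ^ ((1:ℝ)/4) * Real.log (Real.log n) := by
  refine ⟨768 * Real.exp 8 + 1, by positivity, ?_⟩
  have hcast := tendsto_natCast_atTop_atTop (R := ℝ)
  have hL3 := (Real.tendsto_log_atTop.comp hcast).eventually_ge_atTop 3
  have hn2 := ((tendsto_rpow_atTop (by norm_num : (0 : ℝ) < 1 / 24)).comp
    hcast).eventually_ge_atTop 2
  have hLn := hcast.eventually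
    ((isLittleO_log_rpow_atTop (by norm_num : (0 : ℝ) < 1 / 2)).bound one_pos)
  filter_upwards [hL3, hn2, hLn, eventually_ge_atTop 1] with n hL3 hn2 hLn hn1
  simp only [Function.comp_apply] at hL3 hn2
  have hn1' : (1 : ℝ) ≤ n := by exact_mod_cast hn1
  set L := Real.log n with hL
  have hL0 : 0 < L := by linarith
  replace hLn : L ≤ (n : ℝ) ^ ((1 : ℝ) / 2) := by
    rwa [one_mul, Real.norm_of_nonneg hL0.le, Real.norm_of_nonneg (by positivity)] at hLn
  set M := L ^ ((5 : ℝ) / 8) with hM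
  have hMn : M ≤ n :=
    calc M ≤ L ^ (1 : ℝ) := Real.rpow_le_rpow_of_exponent_le (by linarith) (by norm_num)
      _ ≤ (n : ℝ) ^ ((1 : ℝ) / 2) := by rwa [Real.rpow_one]
      _ ≤ (n : ℝ) ^ (1 : ℝ) := Real.rpow_le_rpow_of_exponent_le hn1' (by norm_num)
      _ = n := Real.rpow_one _
  have hM0 : 0 ≤ M := by positivity
  have hlogL : 0 ≤ Real.log L := Real.log_nonneg (by linarith)
  have hMM : M * M / L = L ^ ((1 : ℝ) / 4) := by
    rw [hM, ← Real.rpow_add hL0, ← Real.rpow_sub_one hL0.ne']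
    norm_num
  calc (G n : ℝ) = ∑ k ∈ Icc 1 ⌊M⌋₊,
        ((∑ m ∈ Icc 1 ⌊(n : ℝ) * M⌋₊, b m * b (m + n * k) : ℕ) : ℝ) := by
        rw [G, Nat.cast_sum]
    _ ≤ ∑ k ∈ Icc 1 ⌊M⌋₊, (768 * Real.exp 8 + 1) * (n * M * Real.log L / L) := by
        refine sum_le_sum fun k hk => ?_
        obtain ⟨hk1, hk2⟩ := mem_Icc.1 hk
        exact sum_b_mul_b_le hL hL3 hM hMn hLn hn2 hk1
          ((Nat.cast_le.2 hk2).trans (Nat.floor_le hM0))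
    _ = ⌊M⌋₊ * ((768 * Real.exp 8 + 1) * (n * M * Real.log L / L)) := by
        rw [sum_const, nsmul_eq_mul, Nat.card_Icc, Nat.add_sub_cancel]
    _ ≤ M * ((768 * Real.exp 8 + 1) * (n * M * Real.log L / L)) := by
        gcongr
        exact Nat.floor_le hM0
    _ = (768 * Real.exp 8 + 1) * n * (M * M / L) * Real.log L := by ring
    _ = _ := by rw [hMM]
end
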